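/- arXiv:1606.06586 — 2 statements merged into one kernel-verified Lean document; each statement's English description precedes it below -/
import Mathlib

section
/- Let n ≥ 2, let f : [0,∞) → [0,∞) be a C² function such that x ↦ f(|x|) is a log-concave density on ℝⁿ (in particular f is non-increasing), let R > 0 and set A = ∫₀¹ t^{n−1} f(Rt) dt. Then for every even ψ ∈ C²(𝕊ⁿ⁻¹): A[n f(R) + R f'(R)]·(1/|𝕊ⁿ⁻¹|)∫_{𝕊ⁿ⁻¹} ψ² du − A f(R)·(1/|𝕊ⁿ⁻¹|)∫_{𝕊ⁿ⁻¹} |∇_σψ|² du ≤ f(R)² · ((1/|𝕊ⁿ⁻¹|)∫_{𝕊ⁿ⁻¹} ψ du)². -/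
open MeasureTheory Metric Set Pointwise
open scoped ENNReal RealInnerProductSpace

noncomputable section

/-- The spherical gradient of `ψ` at a unit vector `u`: the tangential component of the
ambient gradient. -/
def sphGrad {n : ℕ} (ψ : EuclideanSpace ℝ (Fin n) → ℝ) (u : EuclideanSpace ℝ (Fin n)) :
    EuclideanSpace ℝ (Fin n) :=
  gradient ψ u - ⟪gradient ψ u, u⟫ • u

/-- The normalised Gaussian radial profile. -/
def gaussianProfile (Z r : ℝ) : ℝ := Z⁻¹ * Real.exp (-r ^ 2 / 2)

section Gaussian

variable {E : Type*} [NormedAddCommGroup E] [InnerProductSpace ℝ E] [FiniteDimensional ℝ E]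
  [MeasurableSpace E] [BorelSpace E]

open ProbabilityTheory

lemma integral_cexp_gaussian_mul_char (t : E) :
    ∫ x : E, Complex.exp (-(‖x‖ ^ 2 : ℝ) / 2) * Complex.exp (⟪x, t⟫ * Complex.I) =
      (∫ x : E, Complex.exp (-(‖x‖ ^ 2 : ℝ) / 2)) * Complex.exp (-‖t‖ ^ 2 / 2) := by
  have h (t : E) := GaussianFourier.integral_cexp_neg_mul_sq_norm_add (V := E) (b := 1 / 2)
    (by norm_num) Complex.I t
  have h0 := h 0
  simp only [inner_zero_left, Complex.ofReal_zero, mul_zero, add_zero, norm_zero] at h0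
  have e0 : ∀ x : E, Complex.exp (-(‖x‖ ^ 2 : ℝ) / 2) = Complex.exp (-(1 / 2) * ‖x‖ ^ 2) := by
    intro x; congr 1; push_cast; ring
  have e1 : ∀ x : E, Complex.exp (-(‖x‖ ^ 2 : ℝ) / 2) * Complex.exp (⟪x, t⟫ * Complex.I)
      = Complex.exp (-(1 / 2) * ‖x‖ ^ 2 + Complex.I * ⟪t, x⟫) := by
    intro x; rw [e0, ← Complex.exp_add, real_inner_comm]; congr 1; ring
  simp_rw [e1, e0, h, h0, Complex.I_sq]
  norm_num

lemma integrable_exp_neg_norm_sq_div_two :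
    Integrable (fun x : E ↦ Real.exp (-‖x‖ ^ 2 / 2)) := by
  have := (GaussianFourier.integrable_cexp_neg_mul_sq_norm_add (V := E) (b := 1 / 2)
    (by norm_num) 0 0).norm
  refine this.congr (.of_forall fun x ↦ ?_)
  simp only [inner_zero_left, Complex.norm_exp]
  congr 1
  rw [← Complex.ofReal_pow, zero_mul, add_zero, show (-(1 / 2) : ℂ) = ((-(1 / 2) : ℝ) : ℂ) by
    push_cast; rfl, Complex.re_ofReal_mul, Complex.ofReal_re]
  ring

/-- The standard Gaussian measure has a radial density with respect to Lebesgue measure. -/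
lemma stdGaussian_eq_withDensity :
    stdGaussian E = volume.withDensity fun x : E ↦
      (Real.toNNReal (gaussianProfile (∫ y : E, Real.exp (-‖y‖ ^ 2 / 2)) ‖x‖) : ℝ≥0∞) := by
  set Z := ∫ y : E, Real.exp (-‖y‖ ^ 2 / 2) with hZ
  have hZpos : 0 < Z := integral_exp_pos integrable_exp_neg_norm_sq_div_two
  have hnn (r : ℝ) : 0 ≤ gaussianProfile Z r := by unfold gaussianProfile; positivity
  have hfin : IsFiniteMeasure (volume.withDensity fun x : E ↦
      (Real.toNNReal (gaussianProfile Z ‖x‖) : ℝ≥0∞)) :=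
    isFiniteMeasure_withDensity_ofReal
      (integrable_exp_neg_norm_sq_div_two.const_mul Z⁻¹).hasFiniteIntegral
  refine Measure.ext_of_charFun (funext fun t ↦ ?_)
  have hmeas : Measurable fun x : E ↦ Real.toNNReal (gaussianProfile Z ‖x‖) := by
    unfold gaussianProfile; fun_prop
  rw [charFun_stdGaussian, charFun_apply, integral_withDensity_eq_integral_smul hmeas]
  have hZc : (∫ x : E, Complex.exp (-(‖x‖ ^ 2 : ℝ) / 2)) = Z := by
    rw [hZ, ← integral_complex_ofReal]
    congr with x
    push_cast
    rfl
  calc _ = (Z : ℂ)⁻¹ * (Z * Complex.exp (-‖t‖ ^ 2 / 2)) := by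
        rw [← mul_assoc, inv_mul_cancel₀ (by exact_mod_cast hZpos.ne'), one_mul]
    _ = _ := by
        rw [← hZc, ← integral_cexp_gaussian_mul_char, hZc, ← integral_const_mul]
        congr with x
        rw [NNReal.smul_def, Real.coe_toNNReal _ (hnn _), gaussianProfile, Complex.real_smul]
        push_cast
        ring

/-- Integration in polar coordinates against a measure with radial density. -/
lemma integral_withDensity_radial_mul_sphere [Nontrivial E] {ρ : ℝ → NNReal} (hρ : Measurable ρ)
    (k : ℝ → ℝ) (h : E → ℝ) :
    ∫ x : E, k ‖x‖ * h (‖x‖⁻¹ • x) ∂(volume.withDensity fun x : E ↦ (ρ ‖x‖ : ℝ≥0∞)) =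
      (∫ u : sphere (0 : E) 1, h u ∂(volume : Measure E).toSphere) *
        ∫ r : Ioi (0 : ℝ), ρ r * k r ∂(Measure.volumeIoiPow (Module.finrank ℝ E - 1)) := by
  calc _ = ∫ x : E, h (‖x‖⁻¹ • x) * (ρ ‖x‖ * k ‖x‖) := by
        rw [integral_withDensity_eq_integral_smul (by fun_prop)]
        congr with x
        rw [NNReal.smul_def, smul_eq_mul]
        ring
    _ = ∫ x : ({0}ᶜ : Set E), h (‖x.1‖⁻¹ • x.1) * (ρ ‖x.1‖ * k ‖x.1‖)
          ∂(volume.comap Subtype.val) := by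
        rw [integral_subtype_comap (measurableSet_singleton _).compl
          fun x : E ↦ h (‖x‖⁻¹ • x) * (ρ ‖x‖ * k ‖x‖), restrict_compl_singleton]
    _ = _ := by
        rw [← integral_prod_mul,
          ← (volume : Measure E).measurePreserving_homeomorphUnitSphereProd.integral_comp
            (Homeomorph.measurableEmbedding _)]
        simp

/-- Under the standard Gaussian measure the norm and the direction are independent, and the
direction is uniformly distributed on the sphere. -/
lemma integral_stdGaussian_radial_mul_sphere [Nontrivial E] (k : ℝ → ℝ) (h : E → ℝ) :
    ∫ x : E, k ‖x‖ * h (‖x‖⁻¹ • x) ∂(stdGaussian E) =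
      (∫ x, k ‖x‖ ∂(stdGaussian E)) *
        ((1 / ((volume : Measure E).toSphere univ).toReal) *
          ∫ u : sphere (0 : E) 1, h u ∂(volume : Measure E).toSphere) := by
  have hmeas : Measurable fun r : ℝ ↦
      Real.toNNReal (gaussianProfile (∫ y : E, Real.exp (-‖y‖ ^ 2 / 2)) r) := by
    unfold gaussianProfile; fun_prop
  have hS : ((volume : Measure E).toSphere univ).toReal ≠ 0 := by
    rw [ENNReal.toReal_ne_zero]
    exact ⟨mt Measure.measure_univ_eq_zero.1 (Measure.toSphere_ne_zero (volume : Measure E)),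
      measure_ne_top _ _⟩
  have h1 := integral_withDensity_radial_mul_sphere hmeas k (fun _ : E ↦ (1 : ℝ))
  rw [stdGaussian_eq_withDensity, integral_withDensity_radial_mul_sphere hmeas]
  simp only [mul_one, integral_const, smul_eq_mul, measureReal_def] at h1
  rw [h1]
  field_simp

end Gaussian

section Wirtinger

/-- Wirtinger's inequality for functions vanishing at both ends of an interval. -/
lemma sq_mul_integral_sq_le_of_dirichlet {g g' : ℝ → ℝ} (hg : ∀ x, HasDerivAt g (g' x) x)
    (hg' : Continuous g') {a b k : ℝ} (hab : a ≤ b) (hk : 0 ≤ k) (hkab : k * (b - a) < Real.pi)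
    (ha : g a = 0) (hb : g b = 0) :
    k ^ 2 * ∫ x in a..b, g x ^ 2 ≤ ∫ x in a..b, g' x ^ 2 := by
  have hgc : Continuous g := continuous_iff_continuousAt.2 fun x ↦ (hg x).continuousAt
  set w : ℝ → ℝ := fun x ↦ -k * Real.tan (k * (x - (a + b) / 2)) with hw
  have hcos : ∀ x ∈ uIcc a b, 0 < Real.cos (k * (x - (a + b) / 2)) := by
    intro x hx
    rw [uIcc_of_le hab] at hx
    have h1 : k * (x - (a + b) / 2) ≤ k * ((b - a) / 2) :=
      mul_le_mul_of_nonneg_left (by linarith [hx.2]) hk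
    have h2 : k * (-((b - a) / 2)) ≤ k * (x - (a + b) / 2) :=
      mul_le_mul_of_nonneg_left (by linarith [hx.1]) hk
    exact Real.cos_pos_of_mem_Ioo ⟨by linarith, by linarith⟩
  have hwd : ∀ x ∈ uIcc a b, HasDerivAt w (-k ^ 2 - w x ^ 2) x := by
    intro x hx
    have hc := (hcos x hx).ne'
    have h1 : HasDerivAt (fun x ↦ k * (x - (a + b) / 2)) (k * 1) x :=
      ((hasDerivAt_id x).sub_const _).const_mul k
    convert! ((Real.hasDerivAt_tan hc).comp x h1).const_mul (-k) using 1
    simp only [hw]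
    rw [Real.tan_eq_sin_div_cos]
    generalize k * (x - (a + b) / 2) = t at hc
    field_simp
    linear_combination k ^ 2 * -Real.sin_sq_add_cos_sq t
  have hwc : ContinuousOn w (uIcc a b) := fun x hx ↦ (hwd x hx).continuousAt.continuousWithinAt
  have hd : ∀ x ∈ uIcc a b, HasDerivAt (fun x ↦ w x * g x ^ 2)
      (g' x ^ 2 - k ^ 2 * g x ^ 2 - (g' x - w x * g x) ^ 2) x := by
    intro x hx
    convert! (hwd x hx).mul ((hg x).pow 2) using 1
    simp
    ring
  have hi1 : IntervalIntegrable (fun x ↦ g' x ^ 2) volume a b :=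
    (hg'.pow 2).intervalIntegrable _ _
  have hi2 : IntervalIntegrable (fun x ↦ k ^ 2 * g x ^ 2) volume a b :=
    (continuous_const.mul (hgc.pow 2)).intervalIntegrable _ _
  have hi3 : IntervalIntegrable (fun x ↦ (g' x - w x * g x) ^ 2) volume a b :=
    ((hg'.continuousOn.sub (hwc.mul hgc.continuousOn)).pow 2).intervalIntegrable
  have h := intervalIntegral.integral_eq_sub_of_hasDerivAt hd ((hi1.sub hi2).sub hi3)
  rw [intervalIntegral.integral_sub (hi1.sub hi2) hi3, intervalIntegral.integral_sub hi1 hi2,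
    intervalIntegral.integral_const_mul, ha, hb] at h
  have hpos : 0 ≤ ∫ x in a..b, (g' x - w x * g x) ^ 2 :=
    intervalIntegral.integral_nonneg hab fun x _ ↦ sq_nonneg _
  linarith

/-- A Wirtinger inequality for antiperiodic functions. -/
lemma three_mul_integral_sq_le_of_antiperiodic {g g' : ℝ → ℝ} (hg : ∀ x, HasDerivAt g (g' x) x)
    (hg' : Continuous g') (hanti : Function.Antiperiodic g (Real.pi / 2)) :
    3 * ∫ x in 0..Real.pi / 2, g x ^ 2 ≤ ∫ x in 0..Real.pi / 2, g' x ^ 2 := by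
  have hπ := Real.pi_pos
  have hgc : Continuous g := continuous_iff_continuousAt.2 fun x ↦ (hg x).continuousAt
  have hanti' : Function.Antiperiodic g' (Real.pi / 2) := by
    intro x
    have h1 : HasDerivAt (fun y ↦ g (y + Real.pi / 2)) (g' (x + Real.pi / 2)) x :=
      (hg _).comp_add_const x _
    have h2 : HasDerivAt (fun y ↦ g (y + Real.pi / 2)) (-g' x) x := by
      rw [show (fun y ↦ g (y + Real.pi / 2)) = fun y ↦ -g y from funext hanti]
      exact (hg x).neg
    exact h1.unique h2
  obtain ⟨a, ha⟩ : ∃ a, g a = 0 := by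
    have h0 : g (Real.pi / 2) = -g 0 := by simpa using hanti 0
    rcases le_total (g 0) 0 with h | h
    · exact mem_range_of_exists_le_of_exists_ge hgc ⟨0, h⟩ ⟨Real.pi / 2, by linarith⟩
    · exact mem_range_of_exists_le_of_exists_ge hgc ⟨Real.pi / 2, by linarith⟩ ⟨0, h⟩
  have hper {h : ℝ → ℝ} (hh : Function.Antiperiodic h (Real.pi / 2)) :
      ∫ x in 0..Real.pi / 2, h x ^ 2 = ∫ x in a..a + Real.pi / 2, h x ^ 2 := by
    have : Function.Periodic (fun x ↦ h x ^ 2) (Real.pi / 2) := fun x ↦ by simp [hh x]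
    simpa using this.intervalIntegral_add_eq 0 a
  rw [hper hanti, hper hanti']
  have h3 : √3 < 2 := by
    rw [Real.sqrt_lt' (by norm_num)]
    norm_num
  have := sq_mul_integral_sq_le_of_dirichlet hg hg' (a := a) (b := a + Real.pi / 2) (k := √3)
    (by linarith) (Real.sqrt_nonneg _) (by nlinarith) ha (by rw [hanti a, ha, neg_zero])
  simpa using this

end Wirtinger

section GreatCircle

variable {E : Type*} [NormedAddCommGroup E] [InnerProductSpace ℝ E]

lemma cos_smul_add_sin_smul_ne_zero {x y : E} (h : ⟪x, y⟫ ^ 2 ≠ ‖x‖ ^ 2 * ‖y‖ ^ 2) (θ : ℝ) :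
    Real.cos θ • x + Real.sin θ • y ≠ 0 := by
  intro h0
  have h1 : ⟪Real.cos θ • x + Real.sin θ • y, x⟫ = 0 := by rw [h0, inner_zero_left]
  have h2 : ⟪Real.cos θ • x + Real.sin θ • y, y⟫ = 0 := by rw [h0, inner_zero_left]
  simp only [inner_add_left, real_inner_smul_left, real_inner_self_eq_norm_sq] at h1 h2
  rw [real_inner_comm] at h1
  apply h
  have hcs := Real.sin_sq_add_cos_sq θ
  set c := Real.cos θ
  set s := Real.sin θ
  set p := ⟪x, y⟫
  linear_combination (p * s - ‖y‖ ^ 2 * c) * h1 + (p * c - ‖x‖ ^ 2 * s) * h2 +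
    (‖x‖ ^ 2 * ‖y‖ ^ 2 - p ^ 2) * hcs

/-- The quarter-turn difference of an even function along the ellipse spanned by `x` and `y`
is controlled by its derivative along the ellipse. -/
lemma three_mul_integral_sq_sub_le_of_even [CompleteSpace E] {F : E → ℝ} {V : E → E}
    (hF : ∀ x ≠ 0, HasGradientAt F (V x) x) (hV : ContinuousOn V {0}ᶜ)
    (heven : ∀ x, F (-x) = F x) {x y : E} (h : ⟪x, y⟫ ^ 2 ≠ ‖x‖ ^ 2 * ‖y‖ ^ 2) :
    3 * ∫ θ in 0..Real.pi / 2, (F (Real.cos θ • x + Real.sin θ • y) -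
        F (-Real.sin θ • x + Real.cos θ • y)) ^ 2 ≤
      ∫ θ in 0..Real.pi / 2,
        (⟪V (Real.cos θ • x + Real.sin θ • y), -Real.sin θ • x + Real.cos θ • y⟫ +
          ⟪V (-Real.sin θ • x + Real.cos θ • y), Real.cos θ • x + Real.sin θ • y⟫) ^ 2 := by
  have hne₁ := cos_smul_add_sin_smul_ne_zero h
  have hne₂ (θ : ℝ) : -Real.sin θ • x + Real.cos θ • y ≠ 0 := by
    simpa [Real.cos_add_pi_div_two, Real.sin_add_pi_div_two] using hne₁ (θ + Real.pi / 2)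
  have hd₁ (θ : ℝ) : HasDerivAt (fun θ ↦ Real.cos θ • x + Real.sin θ • y)
      (-Real.sin θ • x + Real.cos θ • y) θ :=
    ((Real.hasDerivAt_cos θ).smul_const x).add ((Real.hasDerivAt_sin θ).smul_const y)
  have hd₂ (θ : ℝ) : HasDerivAt (fun θ ↦ -Real.sin θ • x + Real.cos θ • y)
      (-(Real.cos θ • x + Real.sin θ • y)) θ := by
    convert! ((Real.hasDerivAt_sin θ).neg.smul_const x).add
      ((Real.hasDerivAt_cos θ).smul_const y) using 1
    module
  have hc₁ : Continuous fun θ ↦ Real.cos θ • x + Real.sin θ • y := by fun_prop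
  have hc₂ : Continuous fun θ ↦ -Real.sin θ • x + Real.cos θ • y := by fun_prop
  refine three_mul_integral_sq_le_of_antiperiodic (fun θ ↦ ?_) ?_ fun θ ↦ ?_
  · convert! ((hF _ (hne₁ θ)).hasFDerivAt.comp_hasDerivAt θ (hd₁ θ)).sub
      ((hF _ (hne₂ θ)).hasFDerivAt.comp_hasDerivAt θ (hd₂ θ)) using 1
    simp only [InnerProductSpace.toDual_apply_apply, inner_neg_right, sub_neg_eq_add]
  · exact ((hV.comp_continuous hc₁ hne₁).inner hc₂).add ((hV.comp_continuous hc₂ hne₂).inner hc₁)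
  · have : -Real.cos θ • x + -Real.sin θ • y = -(Real.cos θ • x + Real.sin θ • y) := by module
    simp only [Real.cos_add_pi_div_two, Real.sin_add_pi_div_two]
    rw [this, heven]
    ring

end GreatCircle

section GaussianPoincare

variable {E : Type*} [NormedAddCommGroup E] [InnerProductSpace ℝ E] [FiniteDimensional ℝ E]
  [MeasurableSpace E] [BorelSpace E]

open ProbabilityTheory

lemma measurePreserving_rotation_stdGaussian (θ : ℝ) :
    MeasurePreserving (ContinuousLinearMap.rotation (E := E) θ)
      ((stdGaussian E).prod (stdGaussian E)) ((stdGaussian E).prod (stdGaussian E)) :=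
  ⟨(ContinuousLinearMap.continuous _).measurable,
    IsGaussian.map_rotation_eq_self (by simp) θ⟩

lemma measurable_uncurry_comp_rotation {G : E × E → ℝ} (hG : Measurable G) :
    Measurable fun q : (E × E) × ℝ ↦ G (ContinuousLinearMap.rotation q.2 q.1) := by
  simp only [ContinuousLinearMap.rotation_apply]
  exact hG.comp (by fun_prop)

lemma integrable_uncurry_comp_rotation {G : E × E → ℝ} (hG : Measurable G)
    (hint : Integrable G ((stdGaussian E).prod (stdGaussian E))) :
    Integrable (fun q : (E × E) × ℝ ↦ G (ContinuousLinearMap.rotation q.2 q.1))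
      (((stdGaussian E).prod (stdGaussian E)).prod
        (volume.restrict (Ioc 0 (Real.pi / 2)))) := by
  refine (integrable_prod_iff'
    (measurable_uncurry_comp_rotation hG).aestronglyMeasurable).2 ⟨?_, ?_⟩
  · exact .of_forall fun θ ↦
      (measurePreserving_rotation_stdGaussian θ).integrable_comp_of_integrable hint
  · refine (integrable_const (∫ p, ‖G p‖ ∂((stdGaussian E).prod (stdGaussian E)))).congr
      (.of_forall fun θ ↦ ?_)
    have := integral_map (μ := (stdGaussian E).prod (stdGaussian E))
      (measurePreserving_rotation_stdGaussian (E := E) θ).measurable.aemeasurable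
      (f := fun p ↦ ‖G p‖) hG.norm.aestronglyMeasurable
    rw [(measurePreserving_rotation_stdGaussian (E := E) θ).map_eq] at this
    exact this

lemma integral_integral_comp_rotation {G : E × E → ℝ} (hG : Measurable G)
    (hint : Integrable G ((stdGaussian E).prod (stdGaussian E))) :
    ∫ p, (∫ θ in 0..Real.pi / 2, G (ContinuousLinearMap.rotation θ p))
        ∂((stdGaussian E).prod (stdGaussian E)) =
      Real.pi / 2 * ∫ p, G p ∂((stdGaussian E).prod (stdGaussian E)) := by
  have hπ : 0 ≤ Real.pi / 2 := by positivity
  simp only [intervalIntegral.integral_of_le hπ]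
  rw [integral_integral_swap (f := fun p θ ↦ G (ContinuousLinearMap.rotation θ p))
    (integrable_uncurry_comp_rotation hG hint)]
  have h (θ : ℝ) : ∫ p, G (ContinuousLinearMap.rotation θ p)
      ∂((stdGaussian E).prod (stdGaussian E)) =
        ∫ p, G p ∂((stdGaussian E).prod (stdGaussian E)) := by
    have := integral_map (μ := (stdGaussian E).prod (stdGaussian E))
      (measurePreserving_rotation_stdGaussian (E := E) θ).measurable.aemeasurable
      (f := G) hG.aestronglyMeasurable
    rw [(measurePreserving_rotation_stdGaussian (E := E) θ).map_eq] at this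
    exact this.symm
  simp [h, hπ]

lemma integrable_integral_comp_rotation {G : E × E → ℝ} (hG : Measurable G)
    (hint : Integrable G ((stdGaussian E).prod (stdGaussian E))) :
    Integrable (fun p ↦ ∫ θ in 0..Real.pi / 2, G (ContinuousLinearMap.rotation θ p))
      ((stdGaussian E).prod (stdGaussian E)) := by
  simp only [intervalIntegral.integral_of_le (show 0 ≤ Real.pi / 2 by positivity)]
  exact (integrable_uncurry_comp_rotation hG hint).integral_prod_left

lemma integral_inner_sq_stdGaussian (v : E) : ∫ x, ⟪v, x⟫ ^ 2 ∂(stdGaussian E) = ‖v‖ ^ 2 := by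
  have h := variance_dual_stdGaussian (innerSL ℝ v)
  rw [variance_of_integral_eq_zero (by fun_prop) (integral_strongDual_stdGaussian _)] at h
  simpa using h

lemma memLp_id_stdGaussian : MemLp (fun x : E ↦ x) 2 (stdGaussian E) :=
  IsGaussian.memLp_id _ 2 (by simp)

lemma integral_norm_sq_stdGaussian :
    ∫ x, ‖x‖ ^ 2 ∂(stdGaussian E) = Module.finrank ℝ E := by
  let b := stdOrthonormalBasis ℝ E
  simp_rw [← fun x ↦ b.sum_sq_inner_right x]
  rw [integral_finsetSum]
  · simp [integral_inner_sq_stdGaussian, b.norm_eq_one]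
  · intro i _
    exact (memLp_id_stdGaussian.const_inner (b i)).integrable_sq

/-- Two independent standard Gaussian vectors are almost surely linearly independent. -/
lemma ae_inner_sq_ne_stdGaussian (hE : 2 ≤ Module.finrank ℝ E) :
    ∀ᵐ p : E × E ∂((stdGaussian E).prod (stdGaussian E)),
      ⟪p.1, p.2⟫ ^ 2 ≠ ‖p.1‖ ^ 2 * ‖p.2‖ ^ 2 := by
  have : Nontrivial E := Module.nontrivial_of_finrank_pos (R := ℝ) (by omega)
  have hac : stdGaussian E ≪ volume := by
    rw [stdGaussian_eq_withDensity]
    exact withDensity_absolutelyContinuous _ _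
  have hm : MeasurableSet {p : E × E | ⟪p.1, p.2⟫ ^ 2 ≠ ‖p.1‖ ^ 2 * ‖p.2‖ ^ 2} :=
    (isClosed_eq (by fun_prop) (by fun_prop)).isOpen_compl.measurableSet
  rw [Measure.ae_prod_iff_ae_ae hm]
  have h0 : ∀ᵐ x ∂(stdGaussian E), x ≠ 0 := hac.ae_le (Measure.ae_ne volume 0)
  filter_upwards [h0] with x hx
  have hspan : (ℝ ∙ x) ≠ ⊤ := by
    intro h
    have := finrank_span_singleton (K := ℝ) hx
    rw [h, finrank_top] at this
    omega
  have hnull : ∀ᵐ y ∂(volume : Measure E), y ∉ (ℝ ∙ x) :=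
    measure_eq_zero_iff_ae_notMem.1 (Measure.addHaar_submodule volume _ hspan)
  filter_upwards [hac.ae_le hnull] with y hy heq
  apply hy
  have habs : |⟪x, y⟫| = ‖x‖ * ‖y‖ := by
    rw [← abs_of_nonneg (show 0 ≤ ‖x‖ * ‖y‖ by positivity), ← sq_eq_sq_iff_abs_eq_abs, heq]
    ring
  by_cases hy0 : y = 0
  · simp [hy0]
  have h1 : |⟪x, y⟫ / (‖x‖ * ‖y‖)| = 1 := by
    rw [abs_div, habs, abs_of_nonneg (by positivity)]
    exact div_self (by positivity)
  obtain ⟨-, r, -, hr⟩ := (abs_real_inner_div_norm_mul_norm_eq_one_iff x y).1 h1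
  exact hr ▸ Submodule.smul_mem _ r (Submodule.mem_span_singleton_self x)

/-- A Gaussian Poincaré inequality for even functions that may be singular at the origin. -/
lemma three_mul_integral_sq_le_of_even_stdGaussian (hE : 2 ≤ Module.finrank ℝ E)
    {F : E → ℝ} {V : E → E} (hF : ∀ x ≠ 0, HasGradientAt F (V x) x) (hV : ContinuousOn V {0}ᶜ)
    (heven : ∀ x, F (-x) = F x) (hFm : Measurable F) (hVm : Measurable V)
    (hF2 : MemLp F 2 (stdGaussian E)) (hV2 : MemLp V 2 (stdGaussian E))
    (hF0 : ∫ x, F x ∂(stdGaussian E) = 0) :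
    3 * ∫ x, F x ^ 2 ∂(stdGaussian E) ≤ 2 * ∫ x, ‖V x‖ ^ 2 ∂(stdGaussian E) := by
  have hπ := Real.pi_pos
  have hF1 : Integrable F (stdGaussian E) := hF2.integrable (by norm_num)
  let μ := (stdGaussian E).prod (stdGaussian E)
  let G : E × E → ℝ := fun p ↦ (F p.1 - F p.2) ^ 2
  let H : E × E → ℝ := fun p ↦ ⟪V p.1, p.2⟫ ^ 2
  let K : E × E → ℝ := fun p ↦ (⟪V p.1, p.2⟫ + ⟪V p.2, p.1⟫) ^ 2
  have hGm : Measurable G := by fun_prop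
  have hHm : Measurable H := by fun_prop
  have hKm : Measurable K := by fun_prop
  have hs1 : Integrable (fun p : E × E ↦ F p.1 ^ 2) μ := hF2.integrable_sq.comp_fst _
  have hs2 : Integrable (fun p : E × E ↦ F p.2 ^ 2) μ := hF2.integrable_sq.comp_snd _
  have hs3 : Integrable (fun p : E × E ↦ 2 * (F p.1 * F p.2)) μ := (hF1.mul_prod hF1).const_mul 2
  have hGe : G = fun p ↦ F p.1 ^ 2 + F p.2 ^ 2 - 2 * (F p.1 * F p.2) := by
    ext p
    simp only [G]
    ring
  have hs12 : Integrable (fun p : E × E ↦ F p.1 ^ 2 + F p.2 ^ 2) μ := hs1.add hs2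
  have hGi : Integrable G μ := hGe ▸ hs12.sub hs3
  have hG : ∫ p, G p ∂μ = 2 * ∫ x, F x ^ 2 ∂(stdGaussian E) := by
    rw [hGe, integral_sub hs12 hs3, integral_add hs1 hs2, integral_const_mul,
      integral_prod_mul, hF0, integral_fun_fst (fun x ↦ F x ^ 2),
      integral_fun_snd (fun x ↦ F x ^ 2)]
    simp
    ring
  have hHi : Integrable H μ := by
    refine (hV2.norm.integrable_sq.mul_prod memLp_id_stdGaussian.norm.integrable_sq).mono'
      hHm.aestronglyMeasurable (.of_forall fun p ↦ ?_)
    simp only [H]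
    rw [Real.norm_of_nonneg (sq_nonneg _), ← mul_pow, ← sq_abs]
    exact pow_le_pow_left₀ (abs_nonneg _) (abs_real_inner_le_norm _ _) 2
  have hH : ∫ p, H p ∂μ = ∫ x, ‖V x‖ ^ 2 ∂(stdGaussian E) := by
    rw [integral_prod _ hHi]
    simp [H, integral_inner_sq_stdGaussian]
  have hHsi : Integrable (fun p : E × E ↦ H p.swap) μ := hHi.swap
  have hHs : ∫ p : E × E, H p.swap ∂μ = ∫ p, H p ∂μ := integral_prod_swap H
  have hKle (p : E × E) : K p ≤ 2 * H p + 2 * H p.swap := by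
    simp only [K, H, Prod.fst_swap, Prod.snd_swap]
    nlinarith [sq_nonneg (⟪V p.1, p.2⟫ - ⟪V p.2, p.1⟫)]
  have hbi : Integrable (fun p : E × E ↦ 2 * H p + 2 * H p.swap) μ :=
    (hHi.const_mul 2).add (hHsi.const_mul 2)
  have hKi : Integrable K μ := hbi.mono' hKm.aestronglyMeasurable (.of_forall fun p ↦ by
    rw [Real.norm_of_nonneg (sq_nonneg _)]; exact hKle p)
  have hK : ∫ p, K p ∂μ ≤ 4 * ∫ x, ‖V x‖ ^ 2 ∂(stdGaussian E) := by
    refine (integral_mono hKi hbi hKle).trans_eq ?_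
    rw [integral_add (hHi.const_mul 2) (hHsi.const_mul 2), integral_const_mul, integral_const_mul,
      hHs, hH]
    ring
  have key : ∫ p, 3 * (∫ θ in 0..Real.pi / 2, G (ContinuousLinearMap.rotation θ p)) ∂μ ≤
      ∫ p, (∫ θ in 0..Real.pi / 2, K (ContinuousLinearMap.rotation θ p)) ∂μ := by
    refine integral_mono_ae ((integrable_integral_comp_rotation hGm hGi).const_mul 3)
      (integrable_integral_comp_rotation hKm hKi) ?_
    filter_upwards [ae_inner_sq_ne_stdGaussian hE] with p hp
    exact three_mul_integral_sq_sub_le_of_even hF hV heven hp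
  rw [integral_const_mul, integral_integral_comp_rotation hGm hGi,
    integral_integral_comp_rotation hKm hKi, hG] at key
  have : Real.pi / 2 * (3 * (2 * ∫ x, F x ^ 2 ∂(stdGaussian E))) ≤
      Real.pi / 2 * (4 * ∫ x, ‖V x‖ ^ 2 ∂(stdGaussian E)) := by
    have := mul_le_mul_of_nonneg_left hK (show 0 ≤ Real.pi / 2 by positivity)
    linarith
  have := le_of_mul_le_mul_left this (by positivity)
  linarith

end GaussianPoincare

section Sphere

open ProbabilityTheory

lemma HasGradientAt.norm_mul_comp_direction {E : Type*} [NormedAddCommGroup E]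
    [InnerProductSpace ℝ E] [CompleteSpace E] {φ : E → ℝ} {g x : E} (hx : x ≠ 0)
    (hφ : HasGradientAt φ g (‖x‖⁻¹ • x)) :
    HasGradientAt (fun y ↦ ‖y‖ * φ (‖y‖⁻¹ • y))
      (φ (‖x‖⁻¹ • x) • ‖x‖⁻¹ • x + (g - ⟪g, ‖x‖⁻¹ • x⟫ • ‖x‖⁻¹ • x)) x := by
  have hx' : ‖x‖ ≠ 0 := norm_ne_zero_iff.2 hx
  have hn : HasFDerivAt (fun y : E ↦ ‖y‖) (‖x‖⁻¹ • innerSL ℝ x) x := by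
    have h := (hasStrictFDerivAt_norm_sq x).hasFDerivAt.sqrt (by positivity)
    simp only [Real.sqrt_sq (norm_nonneg _)] at h
    convert! h using 1
    ext v
    simp
    field_simp
  have hu : HasFDerivAt (fun y : E ↦ ‖y‖⁻¹ • y) _ x :=
    ((hasDerivAt_inv hx').comp_hasFDerivAt x hn).smul (hasFDerivAt_id x)
  rw [hasGradientAt_iff_hasFDerivAt] at hφ ⊢
  have hc : HasFDerivAt (fun y ↦ φ (‖y‖⁻¹ • y)) _ x := HasFDerivAt.comp x (g := φ) hφ hu
  convert! hn.mul hc using 1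
  ext v
  simp [real_inner_smul_right]
  field_simp
  ring

variable {n : ℕ} {ψ : EuclideanSpace ℝ (Fin n) → ℝ}

lemma inner_sphGrad_self {u : EuclideanSpace ℝ (Fin n)} (hu : ‖u‖ = 1) :
    ⟪u, sphGrad ψ u⟫ = 0 := by
  rw [sphGrad, inner_sub_right, real_inner_smul_right, real_inner_self_eq_norm_sq, hu,
    real_inner_comm]
  ring

lemma norm_smul_add_sphGrad_sq {u : EuclideanSpace ℝ (Fin n)} (hu : ‖u‖ = 1) :
    ‖ψ u • u + sphGrad ψ u‖ ^ 2 = ψ u ^ 2 + ‖sphGrad ψ u‖ ^ 2 := by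
  rw [norm_add_sq_real, real_inner_smul_left, inner_sphGrad_self hu, norm_smul, hu, mul_one,
    Real.norm_eq_abs, sq_abs]
  ring

lemma continuous_sphGrad (hψ : ContDiff ℝ 1 ψ) : Continuous (sphGrad ψ) := by
  have : Continuous (gradient ψ) :=
    (InnerProductSpace.toDual ℝ _).symm.continuous.comp (hψ.continuous_fderiv one_ne_zero)
  unfold sphGrad
  fun_prop

lemma integrable_toSphere_of_continuous {h : EuclideanSpace ℝ (Fin n) → ℝ} (hh : Continuous h) :
    Integrable (fun u : sphere (0 : EuclideanSpace ℝ (Fin n)) 1 ↦ h u)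
      (volume : Measure (EuclideanSpace ℝ (Fin n))).toSphere :=
  (hh.comp continuous_subtype_val).integrable_of_hasCompactSupport
    (HasCompactSupport.of_compactSpace _)

/-- A Poincaré inequality on the sphere for even functions with vanishing mean. -/
lemma sphere_poincare_of_even_of_integral_eq_zero (hn : 2 ≤ n) (hψ : ContDiff ℝ 1 ψ)
    (hψeven : ∀ u ∈ sphere (0 : EuclideanSpace ℝ (Fin n)) 1, ψ (-u) = ψ u)
    (h0 : ∫ u : sphere (0 : EuclideanSpace ℝ (Fin n)) 1, ψ u
      ∂(volume : Measure (EuclideanSpace ℝ (Fin n))).toSphere = 0) :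
    n * ∫ u : sphere (0 : EuclideanSpace ℝ (Fin n)) 1, ψ u ^ 2
        ∂(volume : Measure (EuclideanSpace ℝ (Fin n))).toSphere ≤
      ∫ u : sphere (0 : EuclideanSpace ℝ (Fin n)) 1, ‖sphGrad ψ u‖ ^ 2
        ∂(volume : Measure (EuclideanSpace ℝ (Fin n))).toSphere := by
  have hfr : Module.finrank ℝ (EuclideanSpace ℝ (Fin n)) = n := finrank_euclideanSpace_fin
  have : Nontrivial (EuclideanSpace ℝ (Fin n)) :=
    Module.nontrivial_of_finrank_pos (R := ℝ) (by omega)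
  set σ := (volume : Measure (EuclideanSpace ℝ (Fin n))).toSphere with hσ
  let dir : EuclideanSpace ℝ (Fin n) → EuclideanSpace ℝ (Fin n) := fun x ↦ ‖x‖⁻¹ • x
  let W : EuclideanSpace ℝ (Fin n) → EuclideanSpace ℝ (Fin n) := fun u ↦ ψ u • u + sphGrad ψ u
  have hdir1 {x : EuclideanSpace ℝ (Fin n)} (hx : x ≠ 0) : ‖dir x‖ = 1 := norm_smul_inv_norm hx
  have hdirb (x : EuclideanSpace ℝ (Fin n)) : dir x ∈ closedBall 0 1 := by
    rw [mem_closedBall_zero_iff]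
    by_cases hx : x = 0
    · simp [dir, hx]
    · exact (hdir1 hx).le
  have hdirm : Measurable dir := by fun_prop
  have hWc : Continuous W := (hψ.continuous.smul continuous_id).add (continuous_sphGrad hψ)
  have hball := isCompact_closedBall (0 : EuclideanSpace ℝ (Fin n)) 1
  obtain ⟨C, hC⟩ := hball.exists_bound_of_continuousOn hψ.continuous.continuousOn
  obtain ⟨D, hD⟩ := hball.exists_bound_of_continuousOn hWc.continuousOn
  have hFm : Measurable fun x ↦ ‖x‖ * ψ (dir x) :=
    measurable_norm.mul (hψ.continuous.measurable.comp hdirm)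
  have hVm : Measurable fun x ↦ W (dir x) := hWc.measurable.comp hdirm
  have hF2 : MemLp (fun x ↦ ‖x‖ * ψ (dir x)) 2 (stdGaussian (EuclideanSpace ℝ (Fin n))) := by
    refine memLp_id_stdGaussian.of_le_mul (c := C) hFm.aestronglyMeasurable
      (.of_forall fun x ↦ ?_)
    rw [norm_mul, norm_norm, mul_comm]
    exact mul_le_mul_of_nonneg_right (hC _ (hdirb x)) (norm_nonneg _)
  have hV2 : MemLp (fun x ↦ W (dir x)) 2 (stdGaussian (EuclideanSpace ℝ (Fin n))) :=
    .of_bound hVm.aestronglyMeasurable D (.of_forall fun x ↦ hD _ (hdirb x))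
  have key := three_mul_integral_sq_le_of_even_stdGaussian (by omega)
    (F := fun x ↦ ‖x‖ * ψ (dir x)) (V := fun x ↦ W (dir x))
    (fun x hx ↦ (hψ.differentiable one_ne_zero _).hasGradientAt.norm_mul_comp_direction hx)
    (hWc.comp_continuousOn ((continuous_norm.continuousOn.inv₀ fun x hx ↦ by simpa using hx).smul
      continuousOn_id))
    (fun x ↦ by
      by_cases hx : x = 0
      · simp [hx]
      · have hd : dir (-x) = -dir x := by simp [dir]
        rw [hd, norm_neg, hψeven _ (by simpa using hdir1 hx)])
    hFm hVm hF2 hV2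
    (by rw [integral_stdGaussian_radial_mul_sphere (fun r ↦ r) ψ, h0, mul_zero, mul_zero])
  have hac : ∀ᵐ x ∂(stdGaussian (EuclideanSpace ℝ (Fin n))), x ≠ 0 := by
    rw [stdGaussian_eq_withDensity]
    exact (withDensity_absolutelyContinuous _ _).ae_le (Measure.ae_ne volume 0)
  have hL : ∫ x, (‖x‖ * ψ (dir x)) ^ 2 ∂(stdGaussian (EuclideanSpace ℝ (Fin n))) =
      n * ((1 / (σ univ).toReal) * ∫ u, ψ u ^ 2 ∂σ) := by
    simp_rw [mul_pow]
    rw [integral_stdGaussian_radial_mul_sphere (fun r ↦ r ^ 2) (fun u ↦ ψ u ^ 2),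
      integral_norm_sq_stdGaussian, hfr]
  have hR : ∫ x, ‖W (dir x)‖ ^ 2 ∂(stdGaussian (EuclideanSpace ℝ (Fin n))) =
      (1 / (σ univ).toReal) * (∫ u, ψ u ^ 2 ∂σ + ∫ u, ‖sphGrad ψ u‖ ^ 2 ∂σ) := by
    have h1 := integral_stdGaussian_radial_mul_sphere (fun _ ↦ 1)
      (fun u ↦ ψ u ^ 2 + ‖sphGrad ψ u‖ ^ 2)
    have i1 : Integrable (fun u : sphere (0 : EuclideanSpace ℝ (Fin n)) 1 ↦ ψ u ^ 2) σ :=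
      integrable_toSphere_of_continuous (hψ.continuous.pow 2)
    have i2 : Integrable (fun u : sphere (0 : EuclideanSpace ℝ (Fin n)) 1 ↦ ‖sphGrad ψ u‖ ^ 2) σ :=
      integrable_toSphere_of_continuous ((continuous_sphGrad hψ).norm.pow 2)
    rw [integral_add i1 i2] at h1
    simp only [one_mul, integral_const, probReal_univ, smul_eq_mul, mul_one] at h1
    rw [← h1]
    refine integral_congr_ae ?_
    filter_upwards [hac] with x hx
    exact norm_smul_add_sphGrad_sq (hdir1 hx)
  rw [hL, hR] at key
  have hS : 0 < (σ univ).toReal :=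
    ENNReal.toReal_pos (mt Measure.measure_univ_eq_zero.1 (Measure.toSphere_ne_zero _))
      (measure_ne_top _ _)
  have hψ0 : 0 ≤ ∫ u, ψ u ^ 2 ∂σ := integral_nonneg fun _ ↦ sq_nonneg _
  have key' : (1 / (σ univ).toReal) * (3 * (n * ∫ u, ψ u ^ 2 ∂σ)) ≤
      (1 / (σ univ).toReal) * (2 * (∫ u, ψ u ^ 2 ∂σ + ∫ u, ‖sphGrad ψ u‖ ^ 2 ∂σ)) := by
    linarith
  have key'' := le_of_mul_le_mul_left key' (by positivity)
  have hn' : (2 : ℝ) ≤ n := by exact_mod_cast hn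
  nlinarith [mul_le_mul_of_nonneg_right hn' hψ0]

end Sphere

section Radial

lemma concaveOn_log_comp_of_rpow_mul_le {E : Type*} [NormedAddCommGroup E] [NormedSpace ℝ E]
    [Nontrivial E] {f : ℝ → ℝ} {R : ℝ} (hpos : ∀ t ∈ Icc 0 R, 0 < f t)
    (h : ∀ x y : E, ∀ l ∈ Icc (0 : ℝ) 1,
      f ‖x‖ ^ l * f ‖y‖ ^ (1 - l) ≤ f ‖l • x + (1 - l) • y‖) :
    ConcaveOn ℝ (Icc 0 R) fun t ↦ Real.log (f t) := by
  refine ⟨convex_Icc 0 R, fun a ha b hb l m hl hm hlm ↦ ?_⟩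
  obtain ⟨e, he⟩ := exists_norm_eq E zero_le_one
  obtain rfl : m = 1 - l := by linarith
  have hn {c : ℝ} (hc : 0 ≤ c) : ‖c • e‖ = c := by
    rw [norm_smul, he, mul_one, Real.norm_of_nonneg hc]
  have key := h (a • e) (b • e) l ⟨hl, by linarith⟩
  rw [smul_smul, smul_smul, ← add_smul, hn ha.1, hn hb.1,
    hn (add_nonneg (mul_nonneg hl ha.1) (mul_nonneg hm hb.1))] at key
  have hfa := hpos a ha
  have hfb := hpos b hb
  have hlog := Real.log_le_log (by positivity) key
  rwa [Real.log_mul (by positivity) (by positivity), Real.log_rpow hfa, Real.log_rpow hfb] at hlog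

/-- Logarithmic derivatives of log-concave functions decrease. -/
lemma deriv_mul_le_deriv_mul_of_concaveOn_log {f : ℝ → ℝ} {s : Set ℝ} {r R f'r f'R : ℝ}
    (hconc : ConcaveOn ℝ s fun t ↦ Real.log (f t)) (hr : r ∈ s) (hR : R ∈ s) (hrR : r < R)
    (hfr : 0 < f r) (hfR : 0 < f R) (hdr : HasDerivAt f f'r r) (hdR : HasDerivAt f f'R R) :
    f'R * f r ≤ f'r * f R := by
  have h := (hconc.le_slope_of_hasDerivAt hr hR hrR (hdR.log hfR.ne')).trans
    (hconc.slope_le_of_hasDerivAt hr hR hrR (hdr.log hfr.ne'))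
  rwa [div_le_div_iff₀ hfR hfr] at h

lemma AntitoneOn.deriv_nonpos_of_mem_nhds {f : ℝ → ℝ} {s : Set ℝ} {x : ℝ} (hf : AntitoneOn f s)
    (hs : s ∈ nhds x) : deriv f x ≤ 0 := by
  rw [← derivWithin_of_mem_nhds hs]
  exact hf.derivWithin_nonpos

lemma integral_pow_mul_comp_mul_le_sq {f : ℝ → ℝ} {n : ℕ} {R : ℝ} (hn : n ≠ 0) (hR : 0 < R)
    (hf : ContinuousOn f (Ici 0)) (hdiff : ∀ t, 0 < t → DifferentiableAt ℝ f t)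
    (hpos : ∀ t ∈ Icc 0 R, 0 < f t) (hconc : ConcaveOn ℝ (Icc 0 R) fun t ↦ Real.log (f t))
    (hdR : deriv f R ≤ 0) :
    (∫ t in (0 : ℝ)..1, t ^ (n - 1) * f (R * t)) * (n * f R + R * deriv f R) ≤ f R ^ 2 := by
  set g : ℝ → ℝ := fun t ↦ t ^ (n - 1) * f (R * t) with hg
  have hfc : ContinuousOn (fun t ↦ f (R * t)) (Ici 0) :=
    hf.comp (by fun_prop) fun t ht ↦ mul_nonneg hR.le ht
  have hgc : ContinuousOn g (Ici 0) := (continuous_pow _).continuousOn.mul hfc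
  have hgi : IntervalIntegrable g volume 0 1 :=
    (hgc.mono (by rw [uIcc_of_le zero_le_one]; exact Icc_subset_Ici_self)).intervalIntegrable
  let H : ℝ → ℝ := fun s ↦ f R * (s ^ n * f (R * s)) -
    (n * f R + R * deriv f R) * ∫ t in (0 : ℝ)..s, g t
  have hHc : ContinuousOn H (Icc 0 1) := by
    refine (continuousOn_const.mul ((continuous_pow _).continuousOn.mul
      (hfc.mono Icc_subset_Ici_self))).sub (continuousOn_const.mul ?_)
    have := intervalIntegral.continuousOn_primitive_interval (μ := volume) (f := g) (a := 0)
      (b := 1) (by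
        rwa [uIcc_of_le zero_le_one, ← intervalIntegrable_iff_integrableOn_Icc_of_le zero_le_one])
    rwa [uIcc_of_le zero_le_one] at this
  have hHd (s : ℝ) (hs : s ∈ Ioo (0 : ℝ) 1) :
      HasDerivAt H (s ^ (n - 1) * R * (s * deriv f (R * s) * f R - deriv f R * f (R * s))) s := by
    have hRs : 0 < R * s := mul_pos hR hs.1
    have h1 : HasDerivAt (fun s ↦ f (R * s)) (deriv f (R * s) * R) s := by
      have h2 : HasDerivAt (fun s ↦ R * s) R s := by simpa using (hasDerivAt_id s).const_mul R
      exact (hdiff _ hRs).hasDerivAt.comp s h2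
    have hgs : ContinuousAt g s := hgc.continuousAt (Ici_mem_nhds hs.1)
    have h3 : HasDerivAt (fun s ↦ ∫ t in (0 : ℝ)..s, g t) (g s) s :=
      intervalIntegral.integral_hasDerivAt_right
        (hgi.mono_set (by
          rw [uIcc_of_le hs.1.le, uIcc_of_le zero_le_one]
          exact Icc_subset_Icc_right hs.2.le))
        (hgc.mono Ioi_subset_Ici_self |>.stronglyMeasurableAtFilter isOpen_Ioi s hs.1) hgs
    have h4 := (((hasDerivAt_pow n s).mul h1).const_mul (f R)).sub
      (h3.const_mul (n * f R + R * deriv f R))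
    convert! h4 using 1
    obtain ⟨k, rfl⟩ := Nat.exists_eq_succ_of_ne_zero hn
    simp only [hg, Nat.succ_eq_add_one, Nat.add_sub_cancel, pow_succ]
    push_cast
    ring
  have hmono : MonotoneOn H (Icc 0 1) := by
    refine monotoneOn_of_deriv_nonneg (convex_Icc 0 1) hHc ?_ ?_ <;> rw [interior_Icc] <;>
      intro s hs
    · exact (hHd s hs).differentiableAt.differentiableWithinAt
    rw [(hHd s hs).deriv]
    have hRs : 0 < R * s := mul_pos hR hs.1
    have hRs1 : R * s < R := by nlinarith [hs.2]
    have hfs := hpos _ ⟨hRs.le, hRs1.le⟩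
    have hfR := hpos _ ⟨hR.le, le_rfl⟩
    have key := deriv_mul_le_deriv_mul_of_concaveOn_log hconc ⟨hRs.le, hRs1.le⟩ ⟨hR.le, le_rfl⟩
      hRs1 hfs hfR (hdiff _ hRs).hasDerivAt (hdiff _ hR).hasDerivAt
    have h5 : deriv f R * f (R * s) ≤ s * (deriv f R * f (R * s)) := by
      have : deriv f R * f (R * s) ≤ 0 := mul_nonpos_of_nonpos_of_nonneg hdR hfs.le
      nlinarith [hs.2]
    have h6 := mul_le_mul_of_nonneg_left key hs.1.le
    exact mul_nonneg (mul_nonneg (pow_nonneg hs.1.le _) hR.le) (by linarith)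
  have h01 := hmono (left_mem_Icc.2 zero_le_one) (right_mem_Icc.2 zero_le_one) zero_le_one
  simp only [H, zero_pow hn, intervalIntegral.integral_same, one_pow, mul_one, one_mul, zero_mul,
    mul_zero, sub_zero] at h01
  linarith

end Radial

lemma sphGrad_sub_const {n : ℕ} (ψ : EuclideanSpace ℝ (Fin n) → ℝ) (c : ℝ) :
    sphGrad (fun x ↦ ψ x - c) = sphGrad ψ := by
  ext1 u
  simp [sphGrad, gradient, fderiv_sub_const]

/-- A Poincaré inequality on the sphere for even functions. -/
lemma sphere_poincare_of_even {n : ℕ} {ψ : EuclideanSpace ℝ (Fin n) → ℝ} (hn : 2 ≤ n)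
    (hψ : ContDiff ℝ 1 ψ)
    (hψeven : ∀ u ∈ sphere (0 : EuclideanSpace ℝ (Fin n)) 1, ψ (-u) = ψ u) :
    let σ := (volume : Measure (EuclideanSpace ℝ (Fin n))).toSphere
    let m := 1 / (σ univ).toReal * ∫ u, ψ u ∂σ
    m ^ 2 ≤ 1 / (σ univ).toReal * ∫ u, ψ u ^ 2 ∂σ ∧
      n * (1 / (σ univ).toReal * ∫ u, ψ u ^ 2 ∂σ - m ^ 2) ≤
        1 / (σ univ).toReal * ∫ u, ‖sphGrad ψ u‖ ^ 2 ∂σ := by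
  intro σ m
  have : Nontrivial (EuclideanSpace ℝ (Fin n)) :=
    Module.nontrivial_of_finrank_pos (R := ℝ) (by rw [finrank_euclideanSpace_fin]; omega)
  have hS : 0 < (σ univ).toReal :=
    ENNReal.toReal_pos (mt Measure.measure_univ_eq_zero.1 (Measure.toSphere_ne_zero _))
      (measure_ne_top _ _)
  have i1 : Integrable (fun u : sphere (0 : EuclideanSpace ℝ (Fin n)) 1 ↦ ψ u) σ :=
    integrable_toSphere_of_continuous hψ.continuous
  have i2 : Integrable (fun u : sphere (0 : EuclideanSpace ℝ (Fin n)) 1 ↦ ψ u ^ 2) σ :=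
    integrable_toSphere_of_continuous (hψ.continuous.pow 2)
  have hm : ∫ u, ψ u ∂σ = (σ univ).toReal * m := by simp only [m]; field_simp
  have hmean : ∫ u, (ψ u - m) ∂σ = 0 := by
    rw [integral_sub i1 (integrable_const _), integral_const, hm, measureReal_def, smul_eq_mul,
      sub_self]
  have hvar : ∫ u, (ψ u - m) ^ 2 ∂σ = ∫ u, ψ u ^ 2 ∂σ - (σ univ).toReal * m ^ 2 := by
    have h1 : (fun u : sphere (0 : EuclideanSpace ℝ (Fin n)) 1 ↦ (ψ u - m) ^ 2) =
        fun u : sphere (0 : EuclideanSpace ℝ (Fin n)) 1 ↦ ψ u ^ 2 - (2 * m * ψ u - m ^ 2) := by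
      ext u; ring
    have i3 : Integrable (fun u : sphere (0 : EuclideanSpace ℝ (Fin n)) 1 ↦
        2 * m * ψ u - m ^ 2) σ := (i1.const_mul _).sub (integrable_const _)
    rw [h1, integral_sub i2 i3, integral_sub (i1.const_mul _) (integrable_const _),
      integral_const_mul, integral_const, hm,
      measureReal_def, smul_eq_mul]
    ring
  have hvar' : 1 / (σ univ).toReal * ∫ u, ψ u ^ 2 ∂σ - m ^ 2 =
      1 / (σ univ).toReal * ∫ u, (ψ u - m) ^ 2 ∂σ := by
    rw [hvar]; field_simp
  have h0 : 0 ≤ 1 / (σ univ).toReal := by positivity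
  have hpoin := sphere_poincare_of_even_of_integral_eq_zero (ψ := fun x ↦ ψ x - m) hn
    (hψ.sub contDiff_const) (fun u hu ↦ by rw [hψeven u hu]) hmean
  rw [sphGrad_sub_const] at hpoin
  constructor
  · have := mul_nonneg h0 (integral_nonneg (μ := σ) fun u ↦ sq_nonneg (ψ u - m))
    linarith
  · rw [hvar', mul_left_comm]
    exact mul_le_mul_of_nonneg_left hpoin h0

/-- **Validity of the infinitesimal log-Brunn-Minkowski inequality at a ball.**
If `f ∈ C²([0,∞))` is such that `x ↦ f(|x|)` is a log-concave density on `ℝⁿ`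
(in particular `f` is non-increasing), `R > 0` and `A = ∫₀¹ t^(n-1) f(Rt) dt`, then
for every even `ψ ∈ C²(𝕊ⁿ⁻¹)`:
`A[n f(R) + R f'(R)](1/|𝕊ⁿ⁻¹|)∫ψ² - A f(R)(1/|𝕊ⁿ⁻¹|)∫|∇_σψ|²
  ≤ f(R)² ((1/|𝕊ⁿ⁻¹|)∫ψ)²`. -/
theorem infinitesimal_log_BM_at_ball (n : ℕ) (hn : 2 ≤ n)
    (f : ℝ → ℝ) (hf : ContDiffOn ℝ 2 f (Ici 0)) (hfpos : ∀ t ∈ Ici (0:ℝ), 0 ≤ f t)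
    (hlogconc : ∀ x y : EuclideanSpace ℝ (Fin n), ∀ l ∈ Icc (0:ℝ) 1,
      f ‖x‖ ^ l * f ‖y‖ ^ (1 - l) ≤ f ‖l • x + (1 - l) • y‖)
    (hdensity : ∫ x : EuclideanSpace ℝ (Fin n), f ‖x‖ = 1)
    (hmono : AntitoneOn f (Ici 0))
    (R : ℝ) (hR : 0 < R)
    (A : ℝ) (hA : A = ∫ t in (0:ℝ)..1, t ^ (n - 1) * f (R * t))
    (ψ : EuclideanSpace ℝ (Fin n) → ℝ) (hψ : ContDiff ℝ 2 ψ)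
    (hψeven : ∀ u ∈ sphere (0 : EuclideanSpace ℝ (Fin n)) 1, ψ (-u) = ψ u) :
    A * ((n:ℝ) * f R + R * deriv f R)
        * (1 / (((volume : Measure (EuclideanSpace ℝ (Fin n))).toSphere univ).toReal))
        * (∫ u : sphere (0 : EuclideanSpace ℝ (Fin n)) 1, (ψ ↑u) ^ 2
            ∂((volume : Measure (EuclideanSpace ℝ (Fin n))).toSphere))
      - A * f R
          * (1 / (((volume : Measure (EuclideanSpace ℝ (Fin n))).toSphere univ).toReal))
          * (∫ u : sphere (0 : EuclideanSpace ℝ (Fin n)) 1, ‖sphGrad ψ ↑u‖ ^ 2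
              ∂((volume : Measure (EuclideanSpace ℝ (Fin n))).toSphere))
    ≤ (f R) ^ 2
        * ((1 / (((volume : Measure (EuclideanSpace ℝ (Fin n))).toSphere univ).toReal))
            * ∫ u : sphere (0 : EuclideanSpace ℝ (Fin n)) 1, ψ ↑u
                ∂((volume : Measure (EuclideanSpace ℝ (Fin n))).toSphere)) ^ 2 := by
  have : Nontrivial (EuclideanSpace ℝ (Fin n)) :=
    Module.nontrivial_of_finrank_pos (R := ℝ) (by rw [finrank_euclideanSpace_fin]; omega)
  have hA0 : 0 ≤ A := by
    rw [hA]
    exact intervalIntegral.integral_nonneg zero_le_one fun t ht ↦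
      mul_nonneg (pow_nonneg ht.1 _) (hfpos _ (mul_nonneg hR.le ht.1))
  have hfR0 : 0 ≤ f R := hfpos R hR.le
  have hdR : deriv f R ≤ 0 := hmono.deriv_nonpos_of_mem_nhds (Ici_mem_nhds hR)
  have hAB : A * (n * f R + R * deriv f R) ≤ f R ^ 2 := by
    rcases hfR0.eq_or_lt with h0 | h0
    · rw [← h0, mul_zero, zero_add, sq, mul_zero]
      exact mul_nonpos_of_nonneg_of_nonpos hA0 (mul_nonpos_of_nonneg_of_nonpos hR.le hdR)
    · have hpos : ∀ t ∈ Icc 0 R, 0 < f t := fun t ht ↦ h0.trans_le (hmono ht.1 hR.le ht.2)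
      rw [hA]
      exact integral_pow_mul_comp_mul_le_sq (by omega) hR hf.continuousOn
        (fun t ht ↦ (hf.differentiableOn two_ne_zero).differentiableAt (Ici_mem_nhds ht))
        hpos (concaveOn_log_comp_of_rpow_mul_le hpos hlogconc) hdR
  obtain ⟨hV, hD⟩ := sphere_poincare_of_even hn (hψ.of_le one_le_two) hψeven
  rw [mul_assoc _ (1 / _) (integral _ _), mul_assoc _ (1 / _) (integral _ _)]
  set m := 1 / ((volume : Measure (EuclideanSpace ℝ (Fin n))).toSphere univ).toReal *
    ∫ u, ψ u ∂(volume : Measure (EuclideanSpace ℝ (Fin n))).toSphere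
  set V := 1 / ((volume : Measure (EuclideanSpace ℝ (Fin n))).toSphere univ).toReal *
    ∫ u, ψ u ^ 2 ∂(volume : Measure (EuclideanSpace ℝ (Fin n))).toSphere
  set D := 1 / ((volume : Measure (EuclideanSpace ℝ (Fin n))).toSphere univ).toReal *
    ∫ u, ‖sphGrad ψ u‖ ^ 2 ∂(volume : Measure (EuclideanSpace ℝ (Fin n))).toSphere
  have hD' := mul_le_mul_of_nonneg_left hD (mul_nonneg hA0 hfR0)
  have hd : A * (R * deriv f R) * (V - m ^ 2) ≤ 0 :=
    mul_nonpos_of_nonpos_of_nonneg (mul_nonpos_of_nonneg_of_nonpos hA0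
      (mul_nonpos_of_nonneg_of_nonpos hR.le hdR)) (sub_nonneg.2 hV)
  have hm := mul_le_mul_of_nonneg_right hAB (sq_nonneg m)
  linarith
end
end

section
/- Let γ be a rotation invariant measure on ℝⁿ with density f(|x|), f ∈ C²([0,∞)), let R > 0, ψ ∈ C²(𝕊ⁿ⁻¹), and let K_s be the convex body with support function R + sψ for s in a small interval around 0. Set g(s) = γ(K_s). Then g''(0) = R^{n−2} f(R) ( (n−1) ∫_{𝕊ⁿ⁻¹} ψ² du − ∫_{𝕊ⁿ⁻¹} |∇_σψ|² du ) + R^{n−1} f'(R) ∫_{𝕊ⁿ⁻¹} ψ² du. -/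
open MeasureTheory Metric Set
open scoped ENNReal RealInnerProductSpace

noncomputable section

/-- The convex body determined by a function `f` on the sphere (the Wulff shape):
for small `s`, `bodyOf (R + sψ)` is the convex body with support function `R + sψ`. -/
def bodyOf {n : ℕ} (f : EuclideanSpace ℝ (Fin n) → ℝ) : Set (EuclideanSpace ℝ (Fin n)) :=
  {x | ∀ u ∈ sphere (0 : EuclideanSpace ℝ (Fin n)) 1, ⟪x, u⟫ ≤ f u}

/-- The gradient at a unit vector `u` of the degree one homogeneous extension of `h` from the
unit sphere. -/
def homGrad {E : Type*} [NormedAddCommGroup E] [InnerProductSpace ℝ E] [CompleteSpace E]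
    (h : E → ℝ) (u : E) : E :=
  gradient h u + (h u - ⟪gradient h u, u⟫) • u

/-- The supporting half-space of the Wulff shape of `h` with normal `u` touches it at the boundary
point `ρ • θ`, and the angle between `θ` and `u` is at most `π / 3`. -/
structure IsContact {E : Type*} [NormedAddCommGroup E] [InnerProductSpace ℝ E]
    (h : E → ℝ) (θ u : E) (ρ : ℝ) : Prop where
  norm_eq : ‖u‖ = 1
  half_le : 1 / 2 ≤ ⟪θ, u⟫
  mul_eq : ρ * ⟪θ, u⟫ = h u
  mul_le : ∀ w : E, ‖w‖ = 1 → ρ * ⟪θ, w⟫ ≤ h w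

section Wulff

variable {E : Type*} [NormedAddCommGroup E] [InnerProductSpace ℝ E]

lemma hasGradientAt_homExt [CompleteSpace E] {h : E → ℝ} {u : E} (hu : ‖u‖ = 1)
    (hd : DifferentiableAt ℝ h u) :
    HasGradientAt (fun w => ‖w‖ * h (‖w‖⁻¹ • w)) (homGrad h u) u := by
  have hu0 : u ≠ 0 := by
    rintro rfl
    simp at hu
  have hnorm : HasFDerivAt (fun w : E => ‖w‖) (innerSL ℝ u) u := by
    have h1 : HasFDerivAt (fun w : E => ‖w‖ ^ 2) (2 • innerSL ℝ u) u :=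
      (hasStrictFDerivAt_norm_sq u).hasFDerivAt
    have h2 := h1.sqrt (by simp [hu])
    simp only [Real.sqrt_sq (norm_nonneg _), hu] at h2
    convert h2 using 1
    ext v
    simp
  have hinv : HasFDerivAt (fun w : E => ‖w‖⁻¹) (-innerSL ℝ u) u := by
    have := (hasDerivAt_inv (x := ‖u‖) (by simp [hu])).comp_hasFDerivAt u hnorm
    simpa [hu, Function.comp_def] using this
  have hproj := hinv.smul (hasFDerivAt_id u)
  have hpt : ‖u‖⁻¹ • u = u := by simp [hu]
  have hgrad : HasFDerivAt h (InnerProductSpace.toDual ℝ E (gradient h u)) (‖u‖⁻¹ • u) := by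
    rw [hpt]
    exact hd.hasGradientAt.hasFDerivAt
  have := hnorm.mul (HasFDerivAt.comp (f := fun w : E => ‖w‖⁻¹ • w) u hgrad hproj)
  rw [hasGradientAt_iff_hasFDerivAt]
  refine this.congr_fderiv ?_
  ext v
  simp [homGrad, hu]
  ring

lemma IsContact.smul_eq_homGrad [CompleteSpace E] {h : E → ℝ} {θ u : E} {ρ : ℝ}
    (hc : IsContact h θ u ρ) (hd : DifferentiableAt ℝ h u) : ρ • θ = homGrad h u := by
  have hu0 : u ≠ 0 := by
    rintro rfl
    simpa using hc.norm_eq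
  have hmin : IsLocalMin (fun w => ‖w‖ * h (‖w‖⁻¹ • w) - ⟪ρ • θ, w⟫) u := by
    filter_upwards [isOpen_ne.mem_nhds hu0] with w hw
    have hw' : 0 < ‖w‖ := norm_pos_iff.2 hw
    have h1 := hc.mul_le (‖w‖⁻¹ • w) (by simp [norm_smul, hw'.ne'])
    have h2 := mul_le_mul_of_nonneg_left h1 hw'.le
    have h3 := hc.mul_eq
    have h4 : ‖w‖ * (ρ * ⟪θ, ‖w‖⁻¹ • w⟫) = ρ * ⟪θ, w⟫ := by
      rw [inner_smul_right]
      field_simp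
    rw [h4] at h2
    simp only [hc.norm_eq, inner_smul_left, inv_one, one_smul, one_mul]
    simp
    linarith
  have hg := (hasGradientAt_homExt hc.norm_eq hd).hasFDerivAt.sub
    (innerSL ℝ (ρ • θ)).hasFDerivAt
  have h0 := hmin.hasFDerivAt_eq_zero hg
  have : homGrad h u - ρ • θ = 0 := by
    refine ext_inner_right ℝ fun v => ?_
    have := congrArg (fun L => L v) h0
    simpa [inner_sub_left, inner_smul_left] using this
  exact (sub_eq_zero.1 this).symm

lemma homGrad_const_add_mul [CompleteSpace E] {ψ : E → ℝ} {u : E}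
    (hd : DifferentiableAt ℝ ψ u) (R s : ℝ) :
    homGrad (fun w => R + s * ψ w) u = R • u + s • homGrad ψ u := by
  have hg : gradient (fun w => R + s * ψ w) u = s • gradient ψ u := by
    refine HasGradientAt.gradient ?_
    rw [hasGradientAt_iff_hasFDerivAt]
    refine ((hd.hasGradientAt.hasFDerivAt.const_mul s).const_add R).congr_fderiv ?_
    ext v
    simp
  simp only [homGrad, hg, inner_smul_left, smul_add, smul_smul]
  simp only [conj_trivial]
  module

lemma exists_isContact [FiniteDimensional ℝ E] {h : E → ℝ} (hcont : Continuous h) {R ε : ℝ}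
    (hε : 3 * ε < R) (hb : ∀ w : E, ‖w‖ = 1 → |h w - R| ≤ ε) {θ : E} (hθ : ‖θ‖ = 1) :
    ∃ u ρ, IsContact h θ u ρ := by
  have hε0 : 0 ≤ ε := (abs_nonneg _).trans (hb θ hθ)
  set K : Set E := sphere 0 1 ∩ {u | 1 / 2 ≤ ⟪θ, u⟫} with hK
  have hKc : IsCompact K := (isCompact_sphere 0 1).inter_right
    (isClosed_le continuous_const (by fun_prop))
  have hθθ : ⟪θ, θ⟫ = 1 := by rw [real_inner_self_eq_norm_sq, hθ]; norm_num
  have hθK : θ ∈ K := ⟨by simpa using hθ, by simp only [mem_ofPred_eq, hθθ]; norm_num⟩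
  have hco : ContinuousOn (fun u => h u / ⟪θ, u⟫) K := by
    refine hcont.continuousOn.div (by fun_prop) fun u hu => ?_
    have : 1 / 2 ≤ ⟪θ, u⟫ := hu.2
    linarith
  obtain ⟨u, huK, hmin⟩ := hKc.exists_isMinOn ⟨θ, hθK⟩ hco
  have hu1 : ‖u‖ = 1 := by simpa using huK.1
  have hu2 : 1 / 2 ≤ ⟪θ, u⟫ := huK.2
  have hupos : 0 < ⟪θ, u⟫ := by linarith
  have hhu := abs_le.1 (hb u hu1)
  have hρle : h u / ⟪θ, u⟫ ≤ R + ε := by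
    have h1 := isMinOn_iff.1 hmin θ hθK
    have h2 := abs_le.1 (hb θ hθ)
    simp only [hθθ, div_one] at h1
    linarith
  have hρpos : 0 ≤ h u / ⟪θ, u⟫ := div_nonneg (by linarith) hupos.le
  refine ⟨u, h u / ⟪θ, u⟫, hu1, hu2, div_mul_cancel₀ _ hupos.ne', fun w hw => ?_⟩
  have hhw := abs_le.1 (hb w hw)
  by_cases hw2 : 1 / 2 ≤ ⟪θ, w⟫
  · have := isMinOn_iff.1 hmin w ⟨by simpa using hw, hw2⟩
    exact (le_div_iff₀ (by linarith)).1 this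
  · push Not at hw2
    nlinarith

lemma IsContact.mul_slope_le {ψ : E → ℝ} {R s t : ℝ} {θ u v : E} {ρ σ : ℝ}
    (hc : IsContact (fun w => R + s * ψ w) θ u ρ)
    (hd : IsContact (fun w => R + t * ψ w) θ v σ) :
    σ - ρ ≤ (t - s) * (ψ u / ⟪θ, u⟫) := by
  have h1 := hd.mul_le u hc.norm_eq
  have h2 := hc.mul_eq
  have h3 := hc.half_le
  rw [← mul_div_assoc, le_div_iff₀ (by linarith)]
  linarith

end Wulff

/-- `M` bounds `ψ` and `homGrad ψ` on the unit sphere, together with their Lipschitz constants. -/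
structure SphereBound {E : Type*} [NormedAddCommGroup E] [InnerProductSpace ℝ E] [CompleteSpace E]
    (ψ : E → ℝ) (M : ℝ) : Prop where
  pos : 0 < M
  abs_le : ∀ u : E, ‖u‖ = 1 → |ψ u| ≤ M
  norm_le : ∀ u : E, ‖u‖ = 1 → ‖homGrad ψ u‖ ≤ M
  abs_sub_le : ∀ u v : E, ‖u‖ = 1 → ‖v‖ = 1 → |ψ u - ψ v| ≤ M * ‖u - v‖
  norm_sub_le : ∀ u v : E, ‖u‖ = 1 → ‖v‖ = 1 → ‖homGrad ψ u - homGrad ψ v‖ ≤ M * ‖u - v‖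

section Regularity

variable {E : Type*} [NormedAddCommGroup E] [InnerProductSpace ℝ E] [FiniteDimensional ℝ E]

lemma contDiff_gradient {ψ : E → ℝ} (hψ : ContDiff ℝ 2 ψ) : ContDiff ℝ 1 (gradient ψ) := by
  have h : ContDiff ℝ 1 (fderiv ℝ ψ) := hψ.fderiv_right (by norm_num)
  exact (InnerProductSpace.toDual ℝ E).symm.contDiff.comp h

lemma contDiff_homGrad {ψ : E → ℝ} (hψ : ContDiff ℝ 2 ψ) : ContDiff ℝ 1 (homGrad ψ) := by
  have h := contDiff_gradient hψ
  have h' : ContDiff ℝ 1 ψ := hψ.of_le (by norm_num)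
  exact h.add ((h'.sub (h.inner ℝ contDiff_id)).smul contDiff_id)

lemma exists_bound_on_sphere {F : Type*} [NormedAddCommGroup F] [NormedSpace ℝ F] {g : E → F}
    (hg : ContDiff ℝ 1 g) : ∃ M : ℝ, (∀ u : E, ‖u‖ = 1 → ‖g u‖ ≤ M) ∧
      ∀ u v : E, ‖u‖ = 1 → ‖v‖ = 1 → ‖g u - g v‖ ≤ M * ‖u - v‖ := by
  obtain ⟨C, hC⟩ := (isCompact_sphere (0 : E) 1).exists_bound_of_continuousOn
    hg.continuous.continuousOn
  obtain ⟨K, hK⟩ := (hg.locallyLipschitz.locallyLipschitzOn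
    (s := sphere (0 : E) 1)).exists_lipschitzOnWith_of_compact (isCompact_sphere _ _)
  refine ⟨max C K, fun u hu => (hC u (by simpa using hu)).trans (le_max_left _ _),
    fun u v hu hv => ?_⟩
  refine (hK.norm_sub_le (by simpa using hu) (by simpa using hv)).trans ?_
  gcongr
  exact le_max_right _ _

lemma exists_sphereBound {ψ : E → ℝ} (hψ : ContDiff ℝ 2 ψ) : ∃ M, SphereBound ψ M := by
  obtain ⟨A, hA, hA'⟩ := exists_bound_on_sphere (hψ.of_le (by norm_num) : ContDiff ℝ 1 ψ)
  obtain ⟨B, hB, hB'⟩ := exists_bound_on_sphere (contDiff_homGrad hψ)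
  have h1 : A ≤ max 1 (max A B) := (le_max_left _ _).trans (le_max_right _ _)
  have h2 : B ≤ max 1 (max A B) := (le_max_right _ _).trans (le_max_right _ _)
  refine ⟨max 1 (max A B), by positivity, fun u hu => (hA u hu).trans h1,
    fun u hu => (hB u hu).trans h2, fun u v hu hv => (hA' u v hu hv).trans ?_,
    fun u v hu hv => (hB' u v hu hv).trans ?_⟩ <;> gcongr

variable {ψ : E → ℝ} {M R s t : ℝ} {θ η u v : E} {ρ σ : ℝ}

lemma SphereBound.abs_mul_le (hM : SphereBound ψ M) (hs : 3 * (|s| * M) < R) (hu : ‖u‖ = 1) :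
    |s * ψ u| ≤ R / 3 := by
  rw [abs_mul]
  have := mul_le_mul_of_nonneg_left (hM.abs_le u hu) (abs_nonneg s)
  linarith

lemma IsContact.radius_mem (hc : IsContact (fun w => R + s * ψ w) θ u ρ)
    (hM : SphereBound ψ M) (hs : 3 * (|s| * M) < R) (hθ : ‖θ‖ = 1) :
    R / 2 ≤ ρ ∧ ρ ≤ 2 * R := by
  have h1 := abs_le.1 (hM.abs_mul_le hs hθ)
  have h2 := abs_le.1 (hM.abs_mul_le hs hc.norm_eq)
  have h3 := hc.mul_le θ hθ
  have h4 := hc.mul_eq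
  have h5 := hc.half_le
  have h6 : ⟪θ, u⟫ ≤ 1 := by simpa [hθ, hc.norm_eq] using real_inner_le_norm θ u
  rw [real_inner_self_eq_norm_sq, hθ] at h3
  have hR : 0 < R := by
    have := mul_nonneg (abs_nonneg s) hM.pos.le
    linarith
  have hρ : 0 < ρ := by
    by_contra hneg
    nlinarith
  constructor <;> nlinarith

lemma IsContact.radius_sub_le (hc : IsContact (fun w => R + s * ψ w) θ u ρ)
    (hd : IsContact (fun w => R + t * ψ w) η v σ) (hM : SphereBound ψ M)
    (ht : 3 * (|t| * M) < R) (hη : ‖η‖ = 1) :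
    σ - ρ ≤ 2 * (M * |t - s| + 2 * R * ‖θ - η‖) := by
  have h1 := hd.mul_le u hc.norm_eq
  have h2 := hc.mul_eq
  have h3 := hc.half_le
  obtain ⟨h4, h4'⟩ := hd.radius_mem hM ht hη
  have hR : 0 < R := by
    have := mul_nonneg (abs_nonneg t) hM.pos.le
    linarith
  have h5 : ⟪θ - η, u⟫ ≤ ‖θ - η‖ := by
    simpa [hc.norm_eq] using real_inner_le_norm (θ - η) u
  rw [inner_sub_left] at h5
  have h6 : (t - s) * ψ u ≤ M * |t - s| := by
    refine (le_abs_self _).trans ?_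
    rw [abs_mul, mul_comm]
    exact mul_le_mul_of_nonneg_right (hM.abs_le u hc.norm_eq) (abs_nonneg _)
  have h7 : σ * (⟪θ, u⟫ - ⟪η, u⟫) ≤ 2 * R * ‖θ - η‖ :=
    (mul_le_mul_of_nonneg_left h5 (by linarith)).trans
      (mul_le_mul_of_nonneg_right h4' (norm_nonneg _))
  have h8 : (σ - ρ) * ⟪θ, u⟫ ≤ M * |t - s| + 2 * R * ‖θ - η‖ := by linarith
  have h9 : 0 ≤ M * |t - s| + 2 * R * ‖θ - η‖ := by
    have := hM.pos
    positivity
  by_contra hneg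
  push Not at hneg
  nlinarith

lemma IsContact.abs_radius_sub_le (hc : IsContact (fun w => R + s * ψ w) θ u ρ)
    (hd : IsContact (fun w => R + t * ψ w) η v σ) (hM : SphereBound ψ M)
    (hs : 3 * (|s| * M) < R) (ht : 3 * (|t| * M) < R) (hθ : ‖θ‖ = 1) (hη : ‖η‖ = 1) :
    |ρ - σ| ≤ 2 * (M * |s - t| + 2 * R * ‖θ - η‖) := by
  have h1 := hc.radius_sub_le hd hM ht hη
  have h2 := hd.radius_sub_le hc hM hs hθ
  rw [abs_sub_comm t s] at h1
  rw [norm_sub_rev η θ] at h2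
  exact abs_le.2 ⟨by linarith, h2⟩

lemma IsContact.smul_eq (hc : IsContact (fun w => R + s * ψ w) θ u ρ)
    (hψ : Differentiable ℝ ψ) : ρ • θ = R • u + s • homGrad ψ u := by
  rw [← homGrad_const_add_mul (hψ u), hc.smul_eq_homGrad]
  exact ((hψ u).const_mul s).const_add R

lemma IsContact.norm_sub_le (hc : IsContact (fun w => R + s * ψ w) θ u ρ)
    (hd : IsContact (fun w => R + t * ψ w) η v σ) (hM : SphereBound ψ M) (hψ : Differentiable ℝ ψ)
    (hs : 3 * (|s| * M) < R) (ht : 3 * (|t| * M) < R) (hθ : ‖θ‖ = 1) (hη : ‖η‖ = 1) :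
    ‖u - v‖ ≤ 6 / R * (M * |s - t| + 2 * R * ‖θ - η‖) := by
  have hR : 0 < R := by
    have := mul_nonneg (abs_nonneg t) hM.pos.le
    linarith
  have h1 := hc.abs_radius_sub_le hd hM hs ht hθ hη
  obtain ⟨h2, h2'⟩ := hd.radius_mem hM ht hη
  have key : R • (u - v) = (ρ - σ) • θ + σ • (θ - η) - s • (homGrad ψ u - homGrad ψ v)
      - (s - t) • homGrad ψ v := by
    have e1 := hc.smul_eq hψ
    have e2 := hd.smul_eq hψ
    have e3 : R • u = ρ • θ - s • homGrad ψ u := by rw [e1]; abel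
    have e4 : R • v = σ • η - t • homGrad ψ v := by rw [e2]; abel
    rw [smul_sub, e3, e4]
    module
  have hn : ‖R • (u - v)‖ ≤ |ρ - σ| * ‖θ‖ + |σ| * ‖θ - η‖
      + |s| * ‖homGrad ψ u - homGrad ψ v‖ + |s - t| * ‖homGrad ψ v‖ := by
    rw [key]
    refine (_root_.norm_sub_le _ _).trans (add_le_add ((_root_.norm_sub_le _ _).trans
      (add_le_add ((norm_add_le _ _).trans (add_le_add ?_ ?_)) ?_)) ?_) <;>
      rw [norm_smul, Real.norm_eq_abs]
  rw [norm_smul, Real.norm_eq_abs, abs_of_pos hR, hθ, abs_of_nonneg (by linarith : 0 ≤ σ)] at hn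
  have h3 := mul_le_mul_of_nonneg_left (hM.norm_sub_le u v hc.norm_eq hd.norm_eq) (abs_nonneg s)
  have h4 := mul_le_mul_of_nonneg_left (hM.norm_le v hd.norm_eq) (abs_nonneg (s - t))
  have h5 := mul_le_mul_of_nonneg_right h2' (norm_nonneg (θ - η))
  have h6 := mul_le_mul_of_nonneg_right hs.le (norm_nonneg (u - v))
  have h7 : 0 ≤ M * |s - t| := mul_nonneg hM.pos.le (abs_nonneg _)
  have h8 : 0 ≤ R * ‖θ - η‖ := by positivity
  rw [div_mul_eq_mul_div, le_div_iff₀ hR]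
  nlinarith

lemma abs_div_inner_sub_le (hM : SphereBound ψ M) (hθ : ‖θ‖ = 1) (hu : ‖u‖ = 1) (hv : ‖v‖ = 1)
    (hθu : 1 / 2 ≤ ⟪θ, u⟫) (hθv : 1 / 2 ≤ ⟪η, v⟫) :
    |ψ u / ⟪θ, u⟫ - ψ v / ⟪η, v⟫| ≤ 8 * M * (‖u - v‖ + ‖θ - η‖) := by
  have hMp := hM.pos
  have ha : ⟪θ, u⟫ ≤ 1 := by simpa [hθ, hu] using real_inner_le_norm θ u
  have hab : |⟪η, v⟫ - ⟪θ, u⟫| ≤ ‖u - v‖ + ‖θ - η‖ := by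
    have e : ⟪η, v⟫ - ⟪θ, u⟫ = -(⟪θ, u - v⟫ + ⟪θ - η, v⟫) := by
      rw [inner_sub_left, inner_sub_right]
      ring
    rw [e, abs_neg]
    refine (abs_add_le _ _).trans (add_le_add ?_ ?_)
    · simpa [hθ] using abs_real_inner_le_norm θ (u - v)
    · simpa [hv] using abs_real_inner_le_norm (θ - η) v
  have hnum : |(ψ u - ψ v) * ⟪θ, u⟫ + ψ u * (⟪η, v⟫ - ⟪θ, u⟫)|
      ≤ 2 * M * (‖u - v‖ + ‖θ - η‖) := by
    refine (abs_add_le _ _).trans ?_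
    rw [abs_mul, abs_mul, abs_of_nonneg (by linarith : 0 ≤ ⟪θ, u⟫)]
    have h1 : |ψ u - ψ v| * ⟪θ, u⟫ ≤ M * ‖u - v‖ * 1 :=
      mul_le_mul (hM.abs_sub_le u v hu hv) ha (by linarith) (by positivity)
    have h2 : |ψ u| * |⟪η, v⟫ - ⟪θ, u⟫| ≤ M * (‖u - v‖ + ‖θ - η‖) :=
      mul_le_mul (hM.abs_le u hu) hab (abs_nonneg _) hMp.le
    have h3 : 0 ≤ M * ‖θ - η‖ := by positivity
    linarith
  have hden : 1 / 4 ≤ ⟪θ, u⟫ * ⟪η, v⟫ := by nlinarith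
  have e : ψ u / ⟪θ, u⟫ - ψ v / ⟪η, v⟫
      = ((ψ u - ψ v) * ⟪θ, u⟫ + ψ u * (⟪η, v⟫ - ⟪θ, u⟫)) / (⟪θ, u⟫ * ⟪η, v⟫) := by
    have h1 : ⟪θ, u⟫ ≠ 0 := by linarith
    have h2 : ⟪η, v⟫ ≠ 0 := by linarith
    field_simp
    ring
  rw [e, abs_div, abs_of_pos (by linarith : 0 < ⟪θ, u⟫ * ⟪η, v⟫), div_le_iff₀ (by linarith)]
  have h3 : 0 ≤ M * (‖u - v‖ + ‖θ - η‖) := by positivity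
  nlinarith

lemma IsContact.abs_slope_sub_le (hc : IsContact (fun w => R + s * ψ w) θ u ρ)
    (hd : IsContact (fun w => R + t * ψ w) η v σ) (hM : SphereBound ψ M) (hψ : Differentiable ℝ ψ)
    (hs : 3 * (|s| * M) < R) (ht : 3 * (|t| * M) < R) (hθ : ‖θ‖ = 1) (hη : ‖η‖ = 1) :
    |ψ u / ⟪θ, u⟫ - ψ v / ⟪η, v⟫|
      ≤ 8 * M * (6 / R * (M * |s - t| + 2 * R * ‖θ - η‖) + ‖θ - η‖) := by
  refine (abs_div_inner_sub_le hM hθ hc.norm_eq hd.norm_eq hc.half_le hd.half_le).trans ?_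
  have := hM.pos
  gcongr
  exact hc.norm_sub_le hd hM hψ hs ht hθ hη

lemma IsContact.abs_slope_le (hc : IsContact (fun w => R + s * ψ w) θ u ρ)
    (hM : SphereBound ψ M) : |ψ u / ⟪θ, u⟫| ≤ 2 * M := by
  have h := hc.half_le
  rw [abs_div, abs_of_pos (by linarith : 0 < ⟪θ, u⟫), div_le_iff₀ (by linarith)]
  have := hM.abs_le u hc.norm_eq
  have := hM.pos
  nlinarith

lemma isContact_zero_eq (hc : IsContact (fun w => R + (0 : ℝ) * ψ w) θ u ρ)
    (hψ : Differentiable ℝ ψ) (hR : 0 < R) (hθ : ‖θ‖ = 1) : u = θ ∧ ρ = R := by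
  have h1 := hc.smul_eq hψ
  have h2 := hc.mul_eq
  have h3 := hc.half_le
  simp only [zero_smul, add_zero, zero_mul] at h1 h2
  have hρ : 0 < ρ := by
    by_contra hneg
    nlinarith
  have h4 := congrArg norm h1
  rw [norm_smul, norm_smul, hθ, hc.norm_eq, Real.norm_eq_abs, Real.norm_eq_abs, abs_of_pos hρ,
    abs_of_pos hR, mul_one, mul_one] at h4
  subst h4
  exact ⟨(smul_right_injective E hρ.ne' h1).symm, rfl⟩

variable {U : ℝ → E} {P : ℝ → ℝ}

lemma hasDerivAt_radius (hM : SphereBound ψ M) (hψ : Differentiable ℝ ψ) (hθ : ‖θ‖ = 1)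
    (hc : ∀ s, 3 * (|s| * M) < R → IsContact (fun w => R + s * ψ w) θ (U s) (P s))
    (hs : 3 * (|s| * M) < R) : HasDerivAt P (ψ (U s) / ⟪θ, U s⟫) s := by
  have hnhds : ∀ᶠ t in nhds s, 3 * (|t| * M) < R :=
    (isOpen_lt (by fun_prop) continuous_const).mem_nhds hs
  rw [hasDerivAt_iff_isLittleO]
  have hO : (fun t => P t - P s - (t - s) • (ψ (U s) / ⟪θ, U s⟫))
      =O[nhds s] fun t => (t - s) ^ 2 := by
    refine Asymptotics.IsBigO.of_bound (8 * M * (6 / R * M)) ?_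
    filter_upwards [hnhds] with t ht
    have h1 := (hc s hs).mul_slope_le (hc t ht)
    have h2 := (hc t ht).mul_slope_le (hc s hs)
    have h3 := (hc s hs).abs_slope_sub_le (hc t ht) hM hψ hs ht hθ hθ
    simp only [sub_self, norm_zero, mul_zero, add_zero] at h3
    rw [norm_pow, Real.norm_eq_abs, Real.norm_eq_abs, smul_eq_mul]
    have h4 : |(t - s) * (ψ (U s) / ⟪θ, U s⟫ - ψ (U t) / ⟪θ, U t⟫)|
        ≤ |t - s| * (8 * M * (6 / R * (M * |s - t|))) := by
      rw [abs_mul]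
      gcongr
    have h5 := neg_le_of_abs_le h4
    have h6 := le_of_abs_le h4
    rw [abs_sub_comm s t] at h4 h5 h6
    rw [abs_le]
    constructor <;> nlinarith
  refine hO.trans_isLittleO ?_
  have := (Asymptotics.isLittleO_pow_id (n := 2) (𝕜 := ℝ) (by norm_num)).comp_tendsto
    (show Filter.Tendsto (fun t => t - s) (nhds s) (nhds 0) from by
      simpa using (continuous_sub_right s).tendsto s)
  simpa [Function.comp_def] using this

lemma continuousAt_contact (hM : SphereBound ψ M) (hψ : Differentiable ℝ ψ) (hθ : ‖θ‖ = 1)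
    (hc : ∀ s, 3 * (|s| * M) < R → IsContact (fun w => R + s * ψ w) θ (U s) (P s))
    (hs : 3 * (|s| * M) < R) : ContinuousAt U s := by
  have hnhds : ∀ᶠ t in nhds s, 3 * (|t| * M) < R :=
    (isOpen_lt (by fun_prop) continuous_const).mem_nhds hs
  rw [ContinuousAt, tendsto_iff_norm_sub_tendsto_zero]
  refine squeeze_zero' (Filter.Eventually.of_forall fun _ => norm_nonneg _)
    (g := fun t => 6 / R * (M * |t - s|)) ?_ ?_
  · filter_upwards [hnhds] with t ht
    simpa using (hc t ht).norm_sub_le (hc s hs) hM hψ ht hs hθ hθ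
  · have : Continuous fun t => 6 / R * (M * |t - s|) := by fun_prop
    simpa using this.tendsto s

lemma hasDerivAt_contact (hM : SphereBound ψ M) (hψ : Differentiable ℝ ψ)
    (hcont : Continuous (homGrad ψ)) (hR : 0 < R) (hθ : ‖θ‖ = 1)
    (hc : ∀ s, 3 * (|s| * M) < R → IsContact (fun w => R + s * ψ w) θ (U s) (P s)) :
    HasDerivAt U (R⁻¹ • (ψ θ • θ - homGrad ψ θ)) 0 := by
  have h0 : 3 * (|(0 : ℝ)| * M) < R := by simpa using hR
  obtain ⟨hU0, hP0⟩ := isContact_zero_eq (hc 0 h0) hψ hR hθ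
  have hnhds : ∀ᶠ t in nhds (0 : ℝ), 3 * (|t| * M) < R :=
    (isOpen_lt (by fun_prop) continuous_const).mem_nhds h0
  have hP := hasDerivAt_radius hM hψ hθ hc h0
  have hW : HasDerivAt (fun t => t • homGrad ψ (U t)) (homGrad ψ θ) 0 := by
    rw [hasDerivAt_iff_tendsto_slope]
    have hcU := continuousAt_contact hM hψ hθ hc h0
    have : ContinuousAt (fun t => homGrad ψ (U t)) 0 := hcont.continuousAt.comp hcU
    have ht := this.tendsto
    rw [hU0] at ht
    refine (ht.mono_left nhdsWithin_le_nhds).congr' ?_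
    filter_upwards [self_mem_nhdsWithin] with t ht
    have : t ≠ 0 := ht
    simp [slope_def_module, smul_smul, this]
  have hd := ((hP.smul_const θ).sub hW).const_smul R⁻¹
  rw [hU0, real_inner_self_eq_norm_sq, hθ, one_pow, div_one] at hd
  refine hd.congr_of_eventuallyEq ?_
  filter_upwards [hnhds] with t ht
  have := (hc t ht).smul_eq hψ
  simp only [Pi.smul_apply, Pi.sub_apply, this, add_sub_cancel_right, smul_smul,
    inv_mul_cancel₀ hR.ne', one_smul]

lemma hasDerivAt_slope (hM : SphereBound ψ M) (hψ : Differentiable ℝ ψ)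
    (hcont : Continuous (homGrad ψ)) (hR : 0 < R) (hθ : ‖θ‖ = 1)
    (hc : ∀ s, 3 * (|s| * M) < R → IsContact (fun w => R + s * ψ w) θ (U s) (P s)) :
    HasDerivAt (fun s => ψ (U s) / ⟪θ, U s⟫)
      (-(R⁻¹ * ‖gradient ψ θ - ⟪gradient ψ θ, θ⟫ • θ‖ ^ 2)) 0 := by
  have h0 : 3 * (|(0 : ℝ)| * M) < R := by simpa using hR
  obtain ⟨hU0, hP0⟩ := isContact_zero_eq (hc 0 h0) hψ hR hθ
  have hU := hasDerivAt_contact hM hψ hcont hR hθ hc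
  have hθθ : ⟪θ, θ⟫ = 1 := by rw [real_inner_self_eq_norm_sq, hθ]; norm_num
  have hnum : HasDerivAt (fun s => ψ (U s)) _ 0 :=
    HasFDerivAt.comp_hasDerivAt (0 : ℝ) (hψ (U 0)).hasGradientAt.hasFDerivAt hU
  have hden := (innerSL ℝ θ).hasFDerivAt.comp_hasDerivAt (0 : ℝ) hU
  have := hnum.div hden (by simp only [Function.comp_apply, hU0, innerSL_apply_apply, hθθ]; norm_num)
  refine this.congr_deriv ?_
  rw [← real_inner_self_eq_norm_sq]
  simp only [Function.comp_apply, hU0, innerSL_apply_apply, InnerProductSpace.toDual_apply_apply,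
    homGrad, hθθ]
  generalize gradient ψ θ = G
  simp only [inner_sub_left, inner_sub_right, inner_smul_left, inner_smul_right,
    inner_add_right, real_inner_comm G θ, hθθ, conj_trivial]
  ring

end Regularity

section Polar

variable {E : Type*} [NormedAddCommGroup E] [NormedSpace ℝ E] [MeasurableSpace E]

lemma lintegral_volumeIoiPow_indicator_Iic (k : ℕ) {φ : ℝ → ℝ} (hφ : Continuous φ)
    (hφ0 : ∀ t, 0 ≤ φ t) {a : ℝ} (ha : 0 ≤ a) :
    ∫⁻ r : Ioi (0 : ℝ), (Iic a).indicator (fun r => ENNReal.ofReal (φ r)) (r : ℝ)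
      ∂(Measure.volumeIoiPow k) = ENNReal.ofReal (∫ r in (0 : ℝ)..a, r ^ k * φ r) := by
  have hmeas : Measurable ((Iic a).indicator fun r => ENNReal.ofReal (φ r)) :=
    (hφ.measurable.ennreal_ofReal).indicator measurableSet_Iic
  rw [Measure.volumeIoiPow, lintegral_withDensity_eq_lintegral_mul _ (by fun_prop)
    (show Measurable fun r : Ioi (0 : ℝ) => (Iic a).indicator (fun r => ENNReal.ofReal (φ r)) r
      from hmeas.comp measurable_subtype_coe)]
  simp only [Pi.mul_apply]
  rw [lintegral_subtype_comap measurableSet_Ioi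
    (fun r : ℝ => ENNReal.ofReal (r ^ k) * (Iic a).indicator (fun r => ENNReal.ofReal (φ r)) r),
    intervalIntegral.integral_of_le ha, ofReal_integral_eq_lintegral_ofReal]
  · have h1 : ∀ r : ℝ, ENNReal.ofReal (r ^ k) * (Iic a).indicator (fun r => ENNReal.ofReal (φ r)) r
        = (Iic a).indicator (fun r => ENNReal.ofReal (r ^ k) * ENNReal.ofReal (φ r)) r := by
      intro r
      by_cases hr : r ∈ Iic a <;> simp [hr]
    simp_rw [h1]
    rw [lintegral_indicator measurableSet_Iic, Measure.restrict_restrict measurableSet_Iic,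
      Iic_inter_Ioi]
    refine setLIntegral_congr_fun measurableSet_Ioc fun r hr => ?_
    exact (ENNReal.ofReal_mul (pow_nonneg hr.1.le k)).symm
  · exact (((continuous_pow k).mul hφ).intervalIntegrable 0 a).1
  · filter_upwards [ae_restrict_mem measurableSet_Ioc] with r hr
    exact mul_nonneg (pow_nonneg hr.1.le k) (hφ0 r)

lemma toReal_setLIntegral_norm_eq_integral_sphere [FiniteDimensional ℝ E] [Nontrivial E]
    [BorelSpace E] (μ : Measure E) [μ.IsAddHaarMeasure] {φ : ℝ → ℝ} (hφ : Continuous φ)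
    (hφ0 : ∀ t, 0 ≤ φ t) {K : Set E} (hK : MeasurableSet K) {ρ : sphere (0 : E) 1 → ℝ}
    (hρ : Continuous ρ) (hρ0 : ∀ θ, 0 ≤ ρ θ)
    (hmem : ∀ (θ : sphere (0 : E) 1) (r : ℝ), 0 < r → (r • (θ : E) ∈ K ↔ r ≤ ρ θ)) :
    (∫⁻ x in K, ENNReal.ofReal (φ ‖x‖) ∂μ).toReal
      = ∫ θ, (∫ r in (0 : ℝ)..ρ θ, r ^ (Module.finrank ℝ E - 1) * φ r) ∂μ.toSphere := by
  set G : E → ℝ≥0∞ := K.indicator fun x => ENNReal.ofReal (φ ‖x‖) with hG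
  have hGm : Measurable G := (hφ.measurable.comp measurable_norm).ennreal_ofReal.indicator hK
  have hsymm : Measurable fun p : sphere (0 : E) 1 × Ioi (0 : ℝ) =>
      G ((homeomorphUnitSphereProd E).symm p) :=
    hGm.comp (measurable_subtype_coe.comp (homeomorphUnitSphereProd E).symm.measurable)
  have h1 : ∫⁻ x in K, ENNReal.ofReal (φ ‖x‖) ∂μ
      = ∫⁻ θ, ENNReal.ofReal (∫ r in (0 : ℝ)..ρ θ, r ^ (Module.finrank ℝ E - 1) * φ r)
        ∂μ.toSphere := by
    calc ∫⁻ x in K, ENNReal.ofReal (φ ‖x‖) ∂μ = ∫⁻ x, G x ∂μ := (lintegral_indicator hK _).symm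
      _ = ∫⁻ x : ({(0)}ᶜ : Set E), G x ∂(μ.comap (↑)) := by
        rw [lintegral_subtype_comap (measurableSet_singleton _).compl G,
          restrict_compl_singleton]
      _ = ∫⁻ p, G ((homeomorphUnitSphereProd E).symm p)
            ∂(μ.toSphere.prod (Measure.volumeIoiPow (Module.finrank ℝ E - 1))) := by
        rw [← μ.measurePreserving_homeomorphUnitSphereProd.lintegral_comp hsymm]
        simp
      _ = _ := by
        rw [lintegral_prod _ hsymm.aemeasurable]
        refine lintegral_congr fun θ => ?_
        rw [← lintegral_volumeIoiPow_indicator_Iic _ hφ hφ0 (hρ0 θ)]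
        refine lintegral_congr fun r => ?_
        have hr : (0 : ℝ) < r := r.2
        have hθ : ‖(θ : E)‖ = 1 := by simp
        simp only [homeomorphUnitSphereProd_symm_apply_coe, hG, indicator, hmem θ r hr, mem_Iic,
          norm_smul, hθ, Real.norm_eq_abs, abs_of_pos hr, mul_one]
  have hcont : Continuous fun θ => ∫ r in (0 : ℝ)..ρ θ, r ^ (Module.finrank ℝ E - 1) * φ r :=
    (intervalIntegral.continuous_primitive
      (fun a b => ((continuous_pow _).mul hφ).intervalIntegrable a b) 0).comp hρ
  rw [h1, integral_eq_lintegral_of_nonneg_ae (Filter.Eventually.of_forall fun θ => ?_)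
    hcont.aestronglyMeasurable]
  exact intervalIntegral.integral_nonneg (hρ0 θ)
    fun r hr => mul_nonneg (pow_nonneg hr.1 _) (hφ0 r)

end Polar

section Variation

variable {E : Type*} [NormedAddCommGroup E] [InnerProductSpace ℝ E] [FiniteDimensional ℝ E]
  {ψ : E → ℝ} {M R s : ℝ} {U : ℝ → sphere (0 : E) 1 → E} {P : ℝ → sphere (0 : E) 1 → ℝ}

lemma continuous_radius (hM : SphereBound ψ M)
    (hc : ∀ s, 3 * (|s| * M) < R → ∀ θ : sphere (0 : E) 1,
      IsContact (fun w => R + s * ψ w) (θ : E) (U s θ) (P s θ))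
    (hs : 3 * (|s| * M) < R) : Continuous (P s) := by
  refine (LipschitzWith.of_dist_le' (K := 4 * R) fun θ η => ?_).continuous
  have := (hc s hs θ).abs_radius_sub_le (hc s hs η) hM hs hs (by simp) (by simp)
  rw [sub_self, abs_zero, mul_zero, zero_add] at this
  rw [Real.dist_eq, Subtype.dist_eq, dist_eq_norm]
  linarith

lemma continuous_slope (hM : SphereBound ψ M) (hψ : Differentiable ℝ ψ)
    (hc : ∀ s, 3 * (|s| * M) < R → ∀ θ : sphere (0 : E) 1,
      IsContact (fun w => R + s * ψ w) (θ : E) (U s θ) (P s θ))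
    (hs : 3 * (|s| * M) < R) :
    Continuous fun θ : sphere (0 : E) 1 => ψ (U s θ) / ⟪(θ : E), U s θ⟫ := by
  refine (LipschitzWith.of_dist_le' (K := 8 * M * (6 / R * (2 * R) + 1)) fun θ η => ?_).continuous
  have := (hc s hs θ).abs_slope_sub_le (hc s hs η) hM hψ hs hs (by simp) (by simp)
  rw [sub_self, abs_zero, mul_zero, zero_add] at this
  rw [Real.dist_eq, Subtype.dist_eq, dist_eq_norm]
  linarith

variable [MeasurableSpace E] [BorelSpace E] (ν : Measure (sphere (0 : E) 1)) [IsFiniteMeasure ν]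
  {F : ℝ → ℝ}

lemma hasDerivAt_integral_primitive_radius (hM : SphereBound ψ M) (hψ : Differentiable ℝ ψ)
    (hc : ∀ s, 3 * (|s| * M) < R → ∀ θ : sphere (0 : E) 1,
      IsContact (fun w => R + s * ψ w) (θ : E) (U s θ) (P s θ))
    (hF : Continuous F) (hs : 3 * (|s| * M) < R) :
    HasDerivAt (fun s => ∫ θ, (∫ r in (0 : ℝ)..P s θ, F r) ∂ν)
      (∫ θ, F (P s θ) * (ψ (U s θ) / ⟪(θ : E), U s θ⟫) ∂ν) s := by
  have hnhds : {t : ℝ | 3 * (|t| * M) < R} ∈ nhds s :=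
    (isOpen_lt (by fun_prop) continuous_const).mem_nhds hs
  obtain ⟨B, hB⟩ := (isCompact_Icc (a := R / 2) (b := 2 * R)).exists_bound_of_continuousOn
    hF.continuousOn
  have hprim : Continuous fun a => ∫ r in (0 : ℝ)..a, F r :=
    intervalIntegral.continuous_primitive (fun a b => hF.intervalIntegrable a b) 0
  refine (hasDerivAt_integral_of_dominated_loc_of_deriv_le (bound := fun _ => B * (2 * M))
    (F' := fun s θ => F (P s θ) * (ψ (U s θ) / ⟪(θ : E), U s θ⟫))
    hnhds ?_ ?_ ?_ ?_ (integrable_const _) ?_).2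
  · filter_upwards [hnhds] with t ht
    exact (hprim.comp (continuous_radius hM hc ht)).aestronglyMeasurable
  · exact (hprim.comp (continuous_radius hM hc hs)).integrable_of_hasCompactSupport
      (HasCompactSupport.of_compactSpace _)
  · exact ((hF.comp (continuous_radius hM hc hs)).mul
      (continuous_slope hM hψ hc hs)).aestronglyMeasurable
  · refine Filter.Eventually.of_forall fun θ t ht => ?_
    have h1 := hB _ ((hc t ht θ).radius_mem hM ht (by simp))
    rw [norm_mul]
    exact mul_le_mul h1 ((hc t ht θ).abs_slope_le hM) (norm_nonneg _) ((norm_nonneg _).trans h1)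
  · refine Filter.Eventually.of_forall fun θ t ht => ?_
    have h1 := hasDerivAt_radius (U := fun s => U s θ) (P := fun s => P s θ) hM hψ (by simp)
      (fun s hs => hc s hs θ) ht
    exact (hF.integral_hasStrictDerivAt 0 (P t θ)).hasDerivAt.comp t h1

lemma hasDerivAt_integral_mul_slope (hM : SphereBound ψ M) (hψ2 : ContDiff ℝ 2 ψ) (hR : 0 < R)
    (hc : ∀ s, 3 * (|s| * M) < R → ∀ θ : sphere (0 : E) 1,
      IsContact (fun w => R + s * ψ w) (θ : E) (U s θ) (P s θ))
    (hF : Continuous F) (hF1 : ContDiffOn ℝ 1 F (Ioi 0)) :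
    HasDerivAt (fun s => ∫ θ, F (P s θ) * (ψ (U s θ) / ⟪(θ : E), U s θ⟫) ∂ν)
      (∫ θ, (deriv F R * ψ θ ^ 2
        - F R * R⁻¹ * ‖gradient ψ (θ : E) - ⟪gradient ψ (θ : E), θ⟫ • (θ : E)‖ ^ 2) ∂ν) 0 := by
  have hψ : Differentiable ℝ ψ := hψ2.differentiable two_ne_zero
  have h0 : 3 * (|(0 : ℝ)| * M) < R := by simpa using hR
  have hnhds : {t : ℝ | 3 * (|t| * M) < R} ∈ nhds (0 : ℝ) :=
    (isOpen_lt (by fun_prop) continuous_const).mem_nhds h0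
  have hIcc : Icc (R / 2) (2 * R) ⊆ Ioi 0 := fun r hr => (half_pos hR).trans_le hr.1
  obtain ⟨B, hB⟩ := (isCompact_Icc (a := R / 2) (b := 2 * R)).exists_bound_of_continuousOn
    hF.continuousOn
  obtain ⟨C, hC⟩ := (hF1.mono hIcc).exists_lipschitzOnWith one_ne_zero (convex_Icc _ _)
    isCompact_Icc
  rw [lipschitzOnWith_iff_dist_le_mul] at hC
  have hval : ∀ θ : sphere (0 : E) 1, U 0 θ = θ ∧ P 0 θ = R :=
    fun θ => isContact_zero_eq (hc 0 h0 θ) hψ hR (by simp)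
  set D : ℝ := C * (2 * M) * (2 * M) + B * (8 * M * (6 / R * M)) with hD
  have hcont0 (t : ℝ) (ht : 3 * (|t| * M) < R) :
      Continuous fun θ => F (P t θ) * (ψ (U t θ) / ⟪(θ : E), U t θ⟫) :=
    (hF.comp (continuous_radius hM hc ht)).mul (continuous_slope hM hψ hc ht)
  have hgrad := (contDiff_gradient hψ2).continuous
  have hψc := hψ.continuous
  refine (hasDerivAt_integral_of_dominated_loc_of_lip (bound := fun _ => D) hnhds ?_ ?_ ?_ ?_
    (integrable_const _) ?_).2
  · filter_upwards [hnhds] with t ht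
    exact (hcont0 t ht).aestronglyMeasurable
  · exact (hcont0 0 h0).integrable_of_hasCompactSupport (HasCompactSupport.of_compactSpace _)
  · exact Continuous.aestronglyMeasurable (by fun_prop)
  · refine Filter.Eventually.of_forall fun θ => ?_
    rw [lipschitzOnWith_iff_dist_le_mul]
    intro a ha b hb
    have h1 := (hc a ha θ).abs_radius_sub_le (hc b hb θ) hM ha hb (by simp) (by simp)
    have h2 := (hc a ha θ).abs_slope_sub_le (hc b hb θ) hM hψ ha hb (by simp) (by simp)
    have h3 := (hc a ha θ).abs_slope_le hM
    have ha' := (hc a ha θ).radius_mem hM ha (by simp)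
    have hb' := (hc b hb θ).radius_mem hM hb (by simp)
    have h4 := hC _ ha' _ hb'
    have h5 := hB _ hb'
    simp only [sub_self, norm_zero, mul_zero, add_zero] at h1 h2
    rw [Real.dist_eq] at h4
    rw [Real.norm_eq_abs] at h5
    rw [Real.dist_eq, Real.coe_nnabs, Real.dist_eq]
    generalize ψ (U a θ) / ⟪(θ : E), U a θ⟫ = p at h2 h3 ⊢
    generalize ψ (U b θ) / ⟪(θ : E), U b θ⟫ = q at h2 ⊢
    have e : F (P a θ) * p - F (P b θ) * q
        = (F (P a θ) - F (P b θ)) * p + F (P b θ) * (p - q) := by ring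
    rw [e]
    refine le_trans ?_ (mul_le_mul_of_nonneg_right (le_abs_self D) (abs_nonneg _))
    refine (abs_add_le _ _).trans ?_
    rw [abs_mul, abs_mul]
    have h6 : |F (P a θ) - F (P b θ)| * |p| ≤ C * (2 * (M * |a - b|)) * (2 * M) :=
      mul_le_mul (h4.trans (by rw [Real.dist_eq]; gcongr)) h3 (abs_nonneg _) (by
        have := hM.pos
        positivity)
    have h7 : |F (P b θ)| * |p - q| ≤ B * (8 * M * (6 / R * (M * |a - b|))) :=
      mul_le_mul h5 h2 (abs_nonneg _) ((abs_nonneg _).trans h5)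
    rw [hD]
    linarith
  · refine Filter.Eventually.of_forall fun θ => ?_
    have hP := hasDerivAt_radius (U := fun s => U s θ) (P := fun s => P s θ) hM hψ (by simp)
      (fun s hs => hc s hs θ) h0
    have hS := hasDerivAt_slope (U := fun s => U s θ) (P := fun s => P s θ) hM hψ
      (contDiff_homGrad hψ2).continuous hR (by simp) (fun s hs => hc s hs θ)
    have hFd : HasDerivAt F (deriv F R) (P 0 θ) := by
      rw [(hval θ).2]
      exact ((hF1.contDiffAt (Ioi_mem_nhds hR)).differentiableAt one_ne_zero).hasDerivAt
    have := (hFd.comp 0 hP).mul hS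
    refine this.congr_deriv ?_
    simp only [Function.comp_apply, (hval θ).1, (hval θ).2]
    rw [real_inner_self_eq_norm_sq, norm_eq_of_mem_sphere]
    ring

end Variation

lemma isClosed_bodyOf {n : ℕ} (h : EuclideanSpace ℝ (Fin n) → ℝ) : IsClosed (bodyOf h) := by
  simp only [bodyOf, ofPred_forall]
  exact isClosed_biInter fun u _ => isClosed_le (by fun_prop) continuous_const

lemma IsContact.smul_mem_bodyOf_iff {n : ℕ} {h : EuclideanSpace ℝ (Fin n) → ℝ}
    {θ u : EuclideanSpace ℝ (Fin n)} {ρ r : ℝ} (hc : IsContact h θ u ρ) (hr : 0 < r)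
    (hpos : ∀ w, ‖w‖ = 1 → 0 ≤ h w) : r • θ ∈ bodyOf h ↔ r ≤ ρ := by
  constructor
  · intro hmem
    have h1 := hmem u (by simpa using hc.norm_eq)
    have h2 := hc.half_le
    rw [real_inner_smul_left, ← hc.mul_eq] at h1
    exact le_of_mul_le_mul_right h1 (by linarith)
  · intro hle w hw
    have hw1 : ‖w‖ = 1 := by simpa using hw
    rw [real_inner_smul_left]
    rcases le_or_gt 0 ⟪θ, w⟫ with h1 | h1
    · exact (mul_le_mul_of_nonneg_right hle h1).trans (hc.mul_le w hw1)
    · exact (mul_nonpos_of_nonneg_of_nonpos hr.le h1.le).trans (hpos w hw1)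

/-- **Second variation of `γ(K_s)` at a ball.**
Let `γ` be rotation invariant with density `f(|x|)`, `K_s` the body with support function
`R + sψ` and `g(s) = γ(K_s)`.  Then
`g''(0) = R^(n-2) f(R) ((n-1)∫ψ² - ∫|∇_σψ|²) + R^(n-1) f'(R) ∫ψ²`. -/
theorem second_derivative_at_ball (n : ℕ) (hn : 2 ≤ n)
    (γ : Measure (EuclideanSpace ℝ (Fin n)))
    (f : ℝ → ℝ) (hf : ContDiffOn ℝ 2 f (Ici 0)) (hfpos : ∀ t ∈ Ici (0:ℝ), 0 ≤ f t)
    (hγ : γ = volume.withDensity (fun x => ENNReal.ofReal (f ‖x‖)))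
    (R : ℝ) (hR : 0 < R)
    (ψ : EuclideanSpace ℝ (Fin n) → ℝ) (hψ : ContDiff ℝ 2 ψ) :
    deriv (deriv (fun s : ℝ => (γ (bodyOf (fun u => R + s * ψ u))).toReal)) 0
      = R ^ (n - 2) * f R
          * (((n:ℝ) - 1)
              * (∫ u : sphere (0 : EuclideanSpace ℝ (Fin n)) 1, (ψ ↑u) ^ 2
                  ∂((volume : Measure (EuclideanSpace ℝ (Fin n))).toSphere))
            - ∫ u : sphere (0 : EuclideanSpace ℝ (Fin n)) 1, ‖sphGrad ψ ↑u‖ ^ 2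
                  ∂((volume : Measure (EuclideanSpace ℝ (Fin n))).toSphere))
        + R ^ (n - 1) * deriv f R
            * ∫ u : sphere (0 : EuclideanSpace ℝ (Fin n)) 1, (ψ ↑u) ^ 2
                ∂((volume : Measure (EuclideanSpace ℝ (Fin n))).toSphere) := by
  have : Nontrivial (EuclideanSpace ℝ (Fin n)) :=
    Module.nontrivial_of_finrank_pos (R := ℝ) (by rw [finrank_euclideanSpace_fin]; omega)
  obtain ⟨M, hM⟩ := exists_sphereBound hψ
  have hψ1 : Differentiable ℝ ψ := hψ.differentiable two_ne_zero
  have hψc := hψ1.continuous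
  have hex : ∀ (s : ℝ) (θ : sphere (0 : EuclideanSpace ℝ (Fin n)) 1), ∃ u ρ,
      3 * (|s| * M) < R →
        IsContact (fun w => R + s * ψ w) (θ : EuclideanSpace ℝ (Fin n)) u ρ := by
    intro s θ
    by_cases hs : 3 * (|s| * M) < R
    · obtain ⟨u, ρ, h⟩ := exists_isContact (h := fun w => R + s * ψ w) (by fun_prop) hs
        (fun w hw => by
          rw [add_sub_cancel_left, abs_mul]
          exact mul_le_mul_of_nonneg_left (hM.abs_le w hw) (abs_nonneg s))
        (θ := θ) (by simp)
      exact ⟨u, ρ, fun _ => h⟩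
    · exact ⟨0, 0, fun h => absurd h hs⟩
  choose U P hUP using hex
  have hc : ∀ s, 3 * (|s| * M) < R → ∀ θ : sphere (0 : EuclideanSpace ℝ (Fin n)) 1,
      IsContact (fun w => R + s * ψ w) (θ : EuclideanSpace ℝ (Fin n)) (U s θ) (P s θ) :=
    fun s hs θ => hUP s θ hs
  set φ : ℝ → ℝ := fun t => f (max t 0) with hφ
  have hφc : Continuous φ := hf.continuousOn.comp_continuous (by fun_prop) fun t => le_max_right t 0
  have hφ0 : ∀ t, 0 ≤ φ t := fun t => hfpos _ (le_max_right t 0)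
  have hφf : EqOn φ f (Ioi 0) := fun t ht => by
    simp only [hφ, max_eq_left (le_of_lt (mem_Ioi.1 ht))]
  set F : ℝ → ℝ := fun r => r ^ (n - 1) * φ r with hF
  have hFc : Continuous F := (continuous_pow _).mul hφc
  have hF1 : ContDiffOn ℝ 1 F (Ioi 0) := (contDiff_id.pow (n - 1)).contDiffOn.mul
    (((hf.mono Ioi_subset_Ici_self).of_le (by norm_num)).congr hφf)
  have hnhds : ∀ s, 3 * (|s| * M) < R → ∀ᶠ t in nhds s, 3 * (|t| * M) < R := fun s hs =>
    (isOpen_lt (by fun_prop) continuous_const).mem_nhds hs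
  have hg : ∀ s, 3 * (|s| * M) < R → (γ (bodyOf (fun u => R + s * ψ u))).toReal
      = ∫ θ, (∫ r in (0 : ℝ)..P s θ, F r)
        ∂((volume : Measure (EuclideanSpace ℝ (Fin n))).toSphere) := by
    intro s hs
    have hK := (isClosed_bodyOf fun u => R + s * ψ u).measurableSet
    have hγK : γ (bodyOf (fun u => R + s * ψ u))
        = ∫⁻ x in bodyOf (fun u => R + s * ψ u), ENNReal.ofReal (φ ‖x‖) := by
      rw [hγ, withDensity_apply _ hK]
      simp [hφ]
    rw [hγK, toReal_setLIntegral_norm_eq_integral_sphere volume hφc hφ0 hK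
      (continuous_radius hM hc hs)
      (fun θ => (half_pos hR).le.trans ((hc s hs θ).radius_mem hM hs (by simp)).1)
      (fun θ r hr => ?_), finrank_euclideanSpace_fin]
    exact (hc s hs θ).smul_mem_bodyOf_iff hr fun w hw => by
      have := abs_le.1 (hM.abs_mul_le hs hw)
      linarith
  have hg1 : ∀ s, 3 * (|s| * M) < R →
      deriv (fun s => (γ (bodyOf (fun u => R + s * ψ u))).toReal) s
        = ∫ θ, F (P s θ) * (ψ (U s θ) / ⟪(θ : EuclideanSpace ℝ (Fin n)), U s θ⟫)
          ∂((volume : Measure (EuclideanSpace ℝ (Fin n))).toSphere) := fun s hs =>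
    ((hasDerivAt_integral_primitive_radius _ hM hψ1 hc hFc hs).congr_of_eventuallyEq
      ((hnhds s hs).mono hg)).deriv
  have h0 : 3 * (|(0 : ℝ)| * M) < R := by simpa using hR
  rw [((hasDerivAt_integral_mul_slope _ hM hψ hR hc hFc hF1).congr_of_eventuallyEq
    ((hnhds 0 h0).mono hg1)).deriv]
  have hFR : F R = R ^ (n - 1) * f R := by simp only [hF, hφf hR]
  have hpow : R ^ (n - 1) = R ^ (n - 2) * R := by
    rw [← pow_succ]
    congr 1
    omega
  have hdF : deriv F R = ((n : ℝ) - 1) * R ^ (n - 2) * f R + R ^ (n - 1) * deriv f R := by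
    have hfd : HasDerivAt f (deriv f R) R :=
      ((hf.contDiffAt (Ici_mem_nhds hR)).differentiableAt two_ne_zero).hasDerivAt
    have hφd := hfd.congr_of_eventuallyEq (hφf.eventuallyEq_of_mem (Ioi_mem_nhds hR))
    have := ((hasDerivAt_pow (n - 1) R).mul hφd).deriv
    rw [hφf hR, Nat.cast_sub (by omega : 1 ≤ n), Nat.cast_one,
      show n - 1 - 1 = n - 2 by omega] at this
    exact this
  have hgrad := (contDiff_gradient hψ).continuous
  rw [integral_sub, integral_const_mul, integral_const_mul, hFR, hdF]
  · change _ - _ * (∫ u : sphere (0 : EuclideanSpace ℝ (Fin n)) 1, ‖sphGrad ψ ↑u‖ ^ 2 ∂_) = _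
    rw [hpow]
    field_simp
    ring
  · exact Continuous.integrable_of_hasCompactSupport (by fun_prop)
      (HasCompactSupport.of_compactSpace _)
  · exact Continuous.integrable_of_hasCompactSupport (by fun_prop)
      (HasCompactSupport.of_compactSpace _)
end
end
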